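/- arXiv:1208.3110 — 7 statements merged into one kernel-verified Lean document; each statement's English description precedes it below -/
import Mathlib

section
/- Let A be a finite set with |A| = k and at least two elements, let B be a set with at least two elements, and let n ≥ k + 2. If f : A^n → B is totally symmetric, then f is reconstructible: every function g : A^n → B that is a reconstruction of f is equivalent to f. -/
theorem two_card_nonempty {n : ℕ} {I : Finset (Fin n)} (hI : I.card = 2) : I.Nonempty :=
  Finset.card_pos.mp (by omega)

theorem min'_lt_max'_two {n : ℕ} {I : Finset (Fin n)} (hI : I.card = 2) :
    (I.min' (two_card_nonempty hI)).val < (I.max' (two_card_nonempty hI)).val :=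
  Fin.lt_def.mp (I.min'_lt_max'_of_card (by omega))

theorem min'_lt_pred {n : ℕ} {I : Finset (Fin n)} (hI : I.card = 2) :
    (I.min' (two_card_nonempty hI)).val < n - 1 := by
  have h1 := min'_lt_max'_two hI
  have h2 : (I.max' (two_card_nonempty hI)).val < n := (I.max' (two_card_nonempty hI)).isLt
  omega

/-- The identification map `δ_I : Fin n → Fin (n-1)` associated with a 2-element
subset `I` of `Fin n`: it is the identity below `max I`, sends `max I` to `min I`,
and shifts everything above `max I` down by one. -/
def deltaMap {n : ℕ} (I : Finset (Fin n)) (hI : I.card = 2) : Fin n → Fin (n - 1) := fun t =>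
  if h1 : (t : ℕ) < (I.max' (two_card_nonempty hI)).val then
    ⟨(t : ℕ), by have h2 := (I.max' (two_card_nonempty hI)).isLt; omega⟩
  else if h2 : (t : ℕ) = (I.max' (two_card_nonempty hI)).val then
    ⟨(I.min' (two_card_nonempty hI)).val, min'_lt_pred hI⟩
  else
    ⟨(t : ℕ) - 1, by
      have h3 := min'_lt_max'_two hI
      have h4 := t.isLt
      have h5 := (I.max' (two_card_nonempty hI)).isLt
      omega⟩

/-- The identification minor `f_I` of `f`, obtained by identifying the arguments indexed
by the 2-element set `I`. -/
def minor {A B : Type*} {n : ℕ} (f : (Fin n → A) → B) (I : Finset (Fin n)) (hI : I.card = 2) :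
    (Fin (n - 1) → A) → B := fun a => f (fun t => a (deltaMap I hI t))

/-- Two `m`-ary functions are equivalent if one is obtained from the other by
permutation of arguments. -/
def FEquiv {A B : Type*} {m : ℕ} (f g : (Fin m → A) → B) : Prop :=
  ∃ σ : Equiv.Perm (Fin m), ∀ a : Fin m → A, f a = g (fun t => a (σ t))

/-- `g` is a reconstruction of `f`: there is a bijection `φ` of the 2-element subsets
of `Fin n` such that `f_I ≡ g_{φ(I)}` for every such subset `I`. -/
def IsReconstruction {A B : Type*} {n : ℕ} (f g : (Fin n → A) → B) : Prop :=
  ∃ φ : {I : Finset (Fin n) // I.card = 2} ≃ {I : Finset (Fin n) // I.card = 2},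
    ∀ I : {I : Finset (Fin n) // I.card = 2},
      FEquiv (minor f I.1 I.2) (minor g (φ I).1 (φ I).2)

/-- A function is totally symmetric if it is invariant under all permutations of
its arguments. -/
def TotallySymmetric {A B : Type*} {n : ℕ} (f : (Fin n → A) → B) : Prop :=
  ∀ (σ : Equiv.Perm (Fin n)) (a : Fin n → A), f (fun t => a (σ t)) = f a

theorem comb_aux {N : Type*} (p : N → N → N → Prop)
    (ex : ∀ i j, i ≠ j → ∃ m, p i j m)
    (sy : ∀ i j m, p i j m → p j i m)
    (H1 : ∀ i j l u v, i ≠ j → i ≠ l → j ≠ l → p i j u → (u = i ∨ u = j ∨ u = l) →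
      p i l v → v ≠ i → v ≠ j → v ≠ l → False)
    (H3 : ∀ i j u l m i' j' l' u' v', [i, j, u, l, m].Nodup → p i j u → p l m i →
      [i', j', l', u', v'].Nodup → p i' j' u' → p i' l' v' → False)
    (a b c i v : N) (hd : [a, b, c, i, v].Nodup) (h1 : p a b c) (h2 : p a i v) : False := by
  simp only [List.nodup_cons, List.mem_cons, List.not_mem_nil, not_or, or_false,
    not_false_eq_true, List.nodup_nil, and_true] at hd H3
  obtain ⟨⟨hab, hac, hai, hav⟩, ⟨hbc, hbi, hbv⟩, ⟨hci, hcv⟩, hiv⟩ := hd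
  obtain ⟨u, hu⟩ := ex b c hbc
  have hu3 : u = a ∨ u = b ∨ u = c := by
    by_contra hh
    push Not at hh
    exact H1 b a c c u (Ne.symm hab) hbc hac (sy _ _ _ h1) (by simp) hu hh.2.1 hh.1 hh.2.2
  rcases hu3 with rfl | hu3
  · exact H3 u i v b c u b i c v (by grind) h2 hu (by grind) h1 h2
  · obtain ⟨w, hw⟩ := ex b v hbv
    have hw1 : w = b ∨ w = c ∨ w = v := by
      by_contra hh
      push Not at hh
      exact H1 b c v u w hbc hbv hcv hu (by tauto) hw hh.1 hh.2.1 hh.2.2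
    have hw2 : ¬ (w = b ∨ w = v) := fun hh =>
      H1 b v a w c hbv (Ne.symm hab) (Ne.symm hav) hw (by tauto) (sy _ _ _ h1) (Ne.symm hbc) hcv (Ne.symm hac)
    have hwc : w = c := by tauto
    subst hwc
    exact H3 v b w a i a b i w v (by grind) (sy _ _ _ hw) h2 (by grind) h1 h2

theorem comb_main {N : Type*} (p : N → N → N → Prop)
    (h4 : ∀ a b c : N, ∃ i, i ≠ a ∧ i ≠ b ∧ i ≠ c)
    (ex : ∀ i j, i ≠ j → ∃ m, p i j m)
    (sy : ∀ i j m, p i j m → p j i m)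
    (H1 : ∀ i j l u v, i ≠ j → i ≠ l → j ≠ l → p i j u → (u = i ∨ u = j ∨ u = l) →
      p i l v → v ≠ i → v ≠ j → v ≠ l → False)
    (H2 : ∀ i j l m u, [i, j, l, m].Nodup → p i j l → p l m u → (u = l ∨ u = m) → False)
    (H3 : ∀ i j u l m i' j' l' u' v', [i, j, u, l, m].Nodup → p i j u → p l m i →
      [i', j', l', u', v'].Nodup → p i' j' u' → p i' l' v' → False)
    (a b c : N) (hab : a ≠ b) (hac : a ≠ c) (hbc : b ≠ c) (h1 : p a b c) : False := by
  obtain ⟨i, hia, hib, hic⟩ := h4 a b c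
  have key := comb_aux p ex sy H1 H3
  obtain ⟨v, hv⟩ := ex a i hia.symm
  obtain ⟨v', hv'⟩ := ex b i hib.symm
  have e1 : ¬ (v = a ∨ v = i ∨ v = b) := fun hh =>
    H1 a i b v c hia.symm hab hib hv hh h1 hac.symm hic.symm hbc.symm
  have e2 : ¬ (v' = b ∨ v' = i ∨ v' = a) := fun hh =>
    H1 b i a v' c hib.symm hab.symm hia hv' hh (sy _ _ _ h1) hbc.symm hic.symm hac.symm
  push Not at e1 e2
  by_cases hvc : v = c
  · by_cases hvc' : v' = c
    · subst hvc
      subst hvc'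
      obtain ⟨u, hu⟩ := ex i v' hic
      have f1 : u = i ∨ u = a ∨ u = v' := by
        by_contra hh
        push Not at hh
        exact H1 i a v' v' u hia hic hac (sy _ _ _ hv) (by simp) hu hh.1 hh.2.1 hh.2.2
      have f2 : u = i ∨ u = b ∨ u = v' := by
        by_contra hh
        push Not at hh
        exact H1 i b v' v' u hib hic hbc (sy _ _ _ hv') (by simp) hu hh.1 hh.2.1 hh.2.2
      have f3 : u = v' ∨ u = i := by
        grind
      exact H2 a b v' i u (by simp; grind) h1 (sy _ _ _ hu) f3
    · exact key b a c i v' (by simp; grind) (sy _ _ _ h1) hv'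
  · exact key a b c i v (by simp; grind) h1 hv

theorem delta_props {n : ℕ} (I : Finset (Fin n)) (hI : I.card = 2) :
    ∃ i j : Fin n, i ≠ j ∧ I = {i, j} ∧ deltaMap I hI i = deltaMap I hI j ∧
      (∀ t t', t ≠ j → t' ≠ j → deltaMap I hI t = deltaMap I hI t' → t = t') ∧
      (∀ y, ∃ t, t ≠ j ∧ deltaMap I hI t = y) := by
  have hlt := min'_lt_max'_two hI
  refine ⟨I.min' (two_card_nonempty hI), I.max' (two_card_nonempty hI), ?_, ?_, ?_, ?_, ?_⟩
  · intro h
    rw [h] at hlt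
    omega
  · symm
    apply Finset.eq_of_subset_of_card_le
    · intro x hx
      simp only [Finset.mem_insert, Finset.mem_singleton] at hx
      rcases hx with rfl | rfl
      · exact Finset.min'_mem _ _
      · exact Finset.max'_mem _ _
    · rw [hI, Finset.card_pair]
      intro h
      rw [h] at hlt
      omega
  · simp [deltaMap, hlt]
  · intro t t' ht ht' h
    rw [Ne, Fin.ext_iff] at ht ht'
    apply Fin.ext
    unfold deltaMap at h
    split_ifs at h <;> simp only [Fin.mk.injEq] at h <;> omega
  · intro y
    by_cases hy : y.val < (I.max' (two_card_nonempty hI)).val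
    · refine ⟨⟨y.val, by omega⟩, ?_, ?_⟩
      · rw [Ne, Fin.ext_iff]
        simp only
        omega
      · simp [deltaMap, hy]
    · refine ⟨⟨y.val + 1, by omega⟩, ?_, ?_⟩
      · rw [Ne, Fin.ext_iff]
        simp only
        omega
      · unfold deltaMap
        rw [dif_neg (by simp only; omega), dif_neg (by simp only; omega)]
        simp

/-- `g` restricted to tuples with `b i = b j` is `f` with the doubled coordinate moved to `m`. -/
def Prel {A B : Type*} {n : ℕ} (f g : (Fin n → A) → B) (i j m : Fin n) : Prop :=
  ∀ b : Fin n → A, b i = b j → g b = f (Function.update b i (b m))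

theorem Prel_symm {A B : Type*} {n : ℕ} {f g : (Fin n → A) → B} (hf : TotallySymmetric f)
    (i j m : Fin n) (h : Prel f g i j m) : Prel f g j i m := by
  intro b hb
  rw [h b hb.symm, ← hf (Equiv.swap i j)]
  congr 1
  funext t
  by_cases hti : t = i
  · subst hti
    by_cases hj : j = t
    · subst hj; rw [Equiv.swap_self, Function.update_self]; exact Function.update_self ..
    · rw [Equiv.swap_apply_left, Function.update_of_ne hj, Function.update_of_ne (Ne.symm hj), hb]
  · by_cases htj : t = j
    · subst htj
      simp
    · rw [Equiv.swap_apply_of_ne_of_ne hti htj, Function.update_of_ne hti, Function.update_of_ne htj]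

theorem Prel_exists {A B : Type*} {n : ℕ} {f g : (Fin n → A) → B} (hf : TotallySymmetric f)
    (hg : IsReconstruction f g) (i j : Fin n) (hij : i ≠ j) : ∃ m, Prel f g i j m := by
  obtain ⟨φ, hφ⟩ := hg
  have hJ : ({i, j} : Finset (Fin n)).card = 2 := Finset.card_pair hij
  obtain ⟨I, hI⟩ : ∃ I, φ I = ⟨{i, j}, hJ⟩ := φ.surjective _
  have h : FEquiv (minor f I.1 I.2) (minor g {i, j} hJ) := by
    have gen : ∀ J : {I : Finset (Fin n) // I.card = 2}, J = ⟨{i, j}, hJ⟩ →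
        FEquiv (minor f I.1 I.2) (minor g J.1 J.2) →
        FEquiv (minor f I.1 I.2) (minor g {i, j} hJ) := by
      rintro _ rfl h
      exact h
    exact gen _ hI (hφ I)
  obtain ⟨σ, hσ⟩ := h
  obtain ⟨i₁, j₁, hne1, -, heq1, hinj1, -⟩ := delta_props I.1 I.2
  obtain ⟨i₂, j₂, hne2, hset, heq2, hinj2, hsurj2⟩ := delta_props {i, j} hJ
  choose s hs1 hs2 using hsurj2
  have main : Prel f g j₂ i₂ (s (σ.symm (deltaMap I.1 I.2 i₁))) := by
    intro b hb
    have hbs : b = fun t => (b ∘ s) (deltaMap {i, j} hJ t) := by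
      funext t
      by_cases ht : t = j₂
      · subst ht
        rw [hb]
        simp only [Function.comp]
        congr 1
        exact (hinj2 _ _ (hs1 _) hne2 (by rw [hs2, heq2])).symm
      · simp only [Function.comp]
        congr 1
        exact (hinj2 _ _ (hs1 _) ht (by rw [hs2])).symm
    have h3 := hσ (fun t => b (s (σ.symm t)))
    simp only [Equiv.symm_apply_apply] at h3
    have h4 : g b = minor g {i, j} hJ (b ∘ s) := by
      conv_lhs => rw [hbs]
      rfl
    rw [h4]
    change minor g {i, j} hJ (fun t => b (s t)) = _
    rw [← h3]
    unfold minor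
    let π : Fin n → Fin n := fun t => if t = j₁ then j₂ else s (σ.symm (deltaMap I.1 I.2 t))
    have hπ : Function.Injective π := by
      intro t t' htt
      simp only [π] at htt
      split_ifs at htt with h1 h2 h2
      · rw [h1, h2]
      · exact absurd htt.symm (hs1 _)
      · exact absurd htt (hs1 _)
      · apply hinj1 _ _ h1 h2
        have := congrArg (deltaMap {i, j} hJ) htt
        rw [hs2, hs2] at this
        exact σ.symm.injective this
    let e : Equiv.Perm (Fin n) := Equiv.ofBijective π (Finite.injective_iff_bijective.mp hπ)
    rw [← hf e (Function.update b j₂ _)]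
    congr 1
    funext t
    change _ = Function.update b j₂ _ (π t)
    by_cases ht : t = j₁
    · subst ht
      simp [π, heq1]
    · simp only [π, if_neg ht]
      rw [Function.update_of_ne (hs1 _)]
  have hi : i ∈ ({i₂, j₂} : Finset (Fin n)) := by rw [← hset]; simp
  have hj : j ∈ ({i₂, j₂} : Finset (Fin n)) := by rw [← hset]; simp
  simp only [Finset.mem_insert, Finset.mem_singleton] at hi hj
  rcases hi with rfl | rfl <;> rcases hj with rfl | rfl
  · exact absurd rfl hij
  · exact ⟨_, Prel_symm hf _ _ _ main⟩
  · exact ⟨_, main⟩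
  · exact absurd rfl hij

theorem exists_fill {A : Type*} [Nonempty A] {n : ℕ} (l : List (Fin n)) (hl : l.Nodup) (M : Multiset A)
    (hM : M.card + l.length = n) : ∃ c : Fin n → A, ∀ b : Fin n → A, (∀ t, t ∉ l → b t = c t) →
      Finset.univ.val.map b = (l.map b : Multiset A) + M := by
  classical
  have hs : (l.toFinsetᶜ : Finset (Fin n)).card = M.card := by
    rw [Finset.card_compl, List.toFinset_card_of_nodup hl, Fintype.card_fin]; omega
  have : ∃ c : Fin n → A, (l.toFinsetᶜ : Finset (Fin n)).val.map c = M := by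
    generalize (l.toFinsetᶜ : Finset (Fin n)) = s at hs
    clear hM
    induction s using Finset.induction_on generalizing M with
    | empty =>
      refine ⟨fun _ => Classical.arbitrary A, ?_⟩
      simp at hs
      symm
      simpa using hs.symm
    | insert a s ha ih =>
      rw [Finset.card_insert_of_notMem ha] at hs
      obtain ⟨x, M', rfl⟩ : ∃ x M', M = x ::ₘ M' := by
        obtain ⟨x, hx⟩ := Multiset.card_pos_iff_exists_mem.mp (by omega : 0 < M.card)
        exact ⟨x, _, (Multiset.cons_erase hx).symm⟩
      obtain ⟨c, hc⟩ := ih M' (by simpa using hs)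
      refine ⟨Function.update c a x, ?_⟩
      rw [Finset.insert_val_of_notMem ha, Multiset.map_cons, Function.update_self, ← hc]
      congr 1
      apply Multiset.map_congr rfl
      intro t ht
      rw [Function.update_of_ne]
      rintro rfl
      exact ha ht
  obtain ⟨c, hc⟩ := this
  refine ⟨c, fun b hb => ?_⟩
  have h1 : (Finset.univ : Finset (Fin n)).val = l.toFinset.val + (l.toFinsetᶜ : Finset (Fin n)).val := by
    rw [← Finset.union_compl l.toFinset]
    rw [← Finset.disjUnion_eq_union _ _ disjoint_compl_right]
    rfl
  rw [h1, Multiset.map_add, ← hc]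
  congr 1
  · rw [List.toFinset_val, hl.dedup]; rfl
  · apply Multiset.map_congr rfl
    intro t ht
    apply hb
    simpa using ht


theorem exists_factor {A B : Type*} [Nonempty B] {n : ℕ} {f : (Fin n → A) → B}
    (hf : TotallySymmetric f) :
    ∃ F : Multiset A → B, ∀ b, f b = F (Finset.univ.val.map b) := by
  classical
  have key : ∀ b b' : Fin n → A, (Finset.univ.val.map b : Multiset A) = Finset.univ.val.map b' →
      f b = f b' := by
    intro b b' h
    have hc : ∀ c, Nonempty ({t // b t = c} ≃ {t // b' t = c}) := by
      intro c
      rw [← Fintype.card_eq, Fintype.card_subtype, Fintype.card_subtype]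
      have := congrArg (Multiset.count c) h
      rw [Multiset.count_map, Multiset.count_map] at this
      simp only [Finset.card_def, Finset.filter_val]
      simpa [eq_comm] using this
    let e := Equiv.ofFiberEquiv (fun c => (hc c).some)
    have he : ∀ t, b' (e t) = b t := fun t => Equiv.ofFiberEquiv_map _ t
    rw [← hf e b']
    congr 1
    funext t
    exact (he t).symm
  refine ⟨fun M => if h : ∃ b : Fin n → A, Finset.univ.val.map b = M then f h.choose
    else Classical.arbitrary B, fun b => ?_⟩
  have h : ∃ b' : Fin n → A, (Finset.univ.val.map b' : Multiset A) = Finset.univ.val.map b := ⟨b, rfl⟩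
  simp only [dif_pos h]
  exact key _ _ h.choose_spec.symm

theorem bridge {A B : Type*} {n : ℕ} {f g : (Fin n → A) → B} {F : Multiset A → B}
    (hF : ∀ b, f b = F (Finset.univ.val.map b)) (l : List (Fin n)) (hl : l.Nodup)
    (M : Multiset A) (hM : M.card + l.length = n) (b₀ : Fin n → A) {i j u i' j' v : Fin n}
    (hp : Prel f g i j u) (hp' : Prel f g i' j' v)
    (hm : i ∈ l ∧ j ∈ l ∧ u ∈ l ∧ i' ∈ l ∧ j' ∈ l ∧ v ∈ l)
    (h : b₀ i = b₀ j) (h' : b₀ i' = b₀ j') :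
    F ((l.map (Function.update b₀ i (b₀ u)) : List A) + M) =
      F ((l.map (Function.update b₀ i' (b₀ v)) : List A) + M) := by
  classical
  obtain ⟨mi, mj, mu, mi', mj', mv⟩ := hm
  have : Nonempty A := ⟨b₀ i⟩
  obtain ⟨c, hc⟩ := exists_fill l hl M hM
  let b : Fin n → A := fun t => if t ∈ l then b₀ t else c t
  have hb : ∀ t ∈ l, b t = b₀ t := fun t ht => by simp [b, ht]
  have step : ∀ i u, i ∈ l → u ∈ l → f (Function.update b i (b u)) =
      F ((l.map (Function.update b₀ i (b₀ u)) : List A) + M) := by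
    intro i u hi hu
    rw [hF, hc]
    · congr 3
      apply List.map_congr_left
      intro t ht
      by_cases hti : t = i
      · subst hti
        simp [hb u hu]
      · rw [Function.update_of_ne hti, Function.update_of_ne hti, hb t ht]
    · intro t ht
      rw [Function.update_of_ne (by rintro rfl; exact ht hi)]
      simp [b, ht]
  rw [← step i u mi mu, ← step i' v mi' mv, ← hp b (by rw [hb _ mi, hb _ mj, h]),
    ← hp' b (by rw [hb _ mi', hb _ mj', h'])]

theorem perm_rw {A B : Type*} (F : Multiset A → B) {l₁ l₂ l₃ l₄ : List A} (M : Multiset A)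
    (h : F ((l₁ : Multiset A) + M) = F ((l₂ : Multiset A) + M)) (h₁ : l₁.Perm l₃) (h₂ : l₂.Perm l₄) :
    F ((l₃ : Multiset A) + M) = F ((l₄ : Multiset A) + M) := by
  rw [← Multiset.coe_eq_coe.mpr h₁, ← Multiset.coe_eq_coe.mpr h₂, h]

/-- Moving one unit of multiplicity when the total excess sits on two values. -/
def T1 {A B : Type*} (F : Multiset A → B) (n : ℕ) : Prop :=
  ∀ (x w : A) (M : Multiset A), M.card + 4 = n →
    F (([x, x, x, w] : List A) + M) = F (([x, x, w, w] : List A) + M)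

theorem T1_H1 {A B : Type*} {n : ℕ} {f g : (Fin n → A) → B} {F : Multiset A → B}
    (hF : ∀ b, f b = F (Finset.univ.val.map b)) (i j l u v : Fin n) (hij : i ≠ j) (hil : i ≠ l)
    (hjl : j ≠ l) (hp : Prel f g i j u) (hu : u = i ∨ u = j ∨ u = l) (hp' : Prel f g i l v)
    (hvi : v ≠ i) (hvj : v ≠ j) (hvl : v ≠ l) : T1 F n := by
  intro x w M hM
  have hb := bridge hF [i, j, l, v] (by simp; grind) M (by simpa using hM)
    (fun t => if t = v then w else x) hp hp' (by simp; tauto)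
    (by simp [hvi.symm, hvj.symm]) (by simp [hvi.symm, hvl.symm])
  have huv : u ≠ v := by grind
  simp [hij.symm, hil.symm, hvi, hvi.symm, hvj.symm, hvl.symm, huv] at hb
  refine perm_rw F M hb ?_ ?_ <;>
  · classical
    rw [List.perm_iff_count]
    intro y
    simp only [List.count_cons, List.count_nil]
    try ring

theorem T1_H2 {A B : Type*} {n : ℕ} {f g : (Fin n → A) → B} {F : Multiset A → B}
    (hF : ∀ b, f b = F (Finset.univ.val.map b)) (i j l m u : Fin n) (hd : [i, j, l, m].Nodup)
    (hp : Prel f g i j l) (hp' : Prel f g l m u) (hu : u = l ∨ u = m) : T1 F n := by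
  intro x w M hM
  have hb := bridge hF [i, j, l, m] hd M (by simpa using hM)
    (fun t => if t = i ∨ t = j then w else x) hp hp' (by simp; tauto)
    (by simp) (by simp at hd ⊢; grind)
  simp at hd
  have huv : u ≠ i ∧ u ≠ j := by grind
  have hd' : j ≠ i ∧ l ≠ i ∧ m ≠ i ∧ l ≠ j ∧ m ≠ j ∧ m ≠ l := by grind
  simp [hd, hd', huv] at hb
  refine perm_rw F M hb ?_ ?_ <;>
  · classical
    rw [List.perm_iff_count]
    intro y
    simp only [List.count_cons, List.count_nil]
    ring

theorem T1_H3 {A B : Type*} {n : ℕ} {f g : (Fin n → A) → B} {F : Multiset A → B}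
    (hF : ∀ b, f b = F (Finset.univ.val.map b)) (i j u l m i' j' l' u' v' : Fin n)
    (hd : [i, j, u, l, m].Nodup) (hp : Prel f g i j u) (hq : Prel f g l m i)
    (hd' : [i', j', l', u', v'].Nodup) (hp' : Prel f g i' j' u') (hq' : Prel f g i' l' v') :
    T1 F n := by
  have hn : 5 ≤ n := by
    have := hd.length_le_card
    simpa using this
  have D1 : ∀ (x z w : A) (M : Multiset A), M.card + 5 = n →
      F (([x, z, z, w, w] : List A) + M) = F (([x, x, x, z, w] : List A) + M) := by
    intro x z w M hM
    have hb := bridge hF [i, j, u, l, m] hd M (by simpa using hM)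
      (fun t => if t = i ∨ t = j then x else if t = u then z else w) hp hq (by simp)
      (by simp) (by simp at hd ⊢; grind)
    simp at hd
    have hd2 : j ≠ i ∧ u ≠ i ∧ u ≠ j ∧ l ≠ i ∧ m ≠ i ∧ l ≠ j ∧ m ≠ j ∧ m ≠ l ∧ l ≠ u ∧ m ≠ u := by
      grind
    simp [hd, hd2] at hb
    refine perm_rw F M hb ?_ ?_ <;>
    · classical
      rw [List.perm_iff_count]
      intro y
      simp only [List.count_cons, List.count_nil]
      ring
  have T2 : ∀ (x w v : A) (M : Multiset A), M.card + 5 = n →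
      F (([x, x, w, w, v] : List A) + M) = F (([x, x, w, v, v] : List A) + M) := by
    intro x w v M hM
    have hb := bridge hF [i', j', l', u', v'] hd' M (by simpa using hM)
      (fun t => if t = u' then w else if t = v' then v else x) hp' hq' (by simp)
      (by simp at hd' ⊢; grind) (by simp at hd' ⊢; grind)
    simp at hd'
    have hd2 : j' ≠ i' ∧ l' ≠ i' ∧ l' ≠ j' ∧ u' ≠ i' ∧ v' ≠ i' ∧ u' ≠ j' ∧ v' ≠ j' ∧ v' ≠ u' ∧
        u' ≠ l' ∧ v' ≠ l' := by
      grind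
    simp [hd', hd2] at hb
    refine perm_rw F M hb ?_ ?_ <;>
    · classical
      rw [List.perm_iff_count]
      intro y
      simp only [List.count_cons, List.count_nil]
      ring
  classical
  intro x w M hM
  obtain ⟨v, M', rfl⟩ : ∃ v M', M = v ::ₘ M' := by
    obtain ⟨x, hx⟩ := Multiset.card_pos_iff_exists_mem.mp (by omega : 0 < M.card)
    exact ⟨x, _, (Multiset.cons_erase hx).symm⟩
  have hM' : M'.card + 5 = n := by simp at hM; omega
  have e1 := (D1 x w v M' hM').symm.trans (perm_rw F (l₃ := [x, w, w, v, v])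
    (l₄ := [x, x, w, w, v]) M' (T2 w v x M' hM') ?_ ?_)
  · convert e1 using 2
    · rw [← Multiset.singleton_add, ← add_assoc]; rfl
    · rw [← Multiset.singleton_add, ← add_assoc]; rfl
  all_goals
    classical
    rw [List.perm_iff_count]
    intro y
    simp only [List.count_cons, List.count_nil]
    ring

theorem T1_full {A B : Type*} [Fintype A] {n : ℕ} {F : Multiset A → B}
    (hn : Fintype.card A + 2 ≤ n) (h : T1 F n) (x z : A) (M : Multiset A) (hM : M.card + 3 = n) :
    F (([x, x, z] : List A) + M) = F (([x, z, z] : List A) + M) := by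
  classical
  by_cases hxz : x = z
  · rw [hxz]
  by_cases hx : x ∈ M
  · obtain ⟨M', rfl⟩ := Multiset.exists_cons_of_mem hx
    convert h x z M' (by simp at hM; omega) using 2 <;>
    · ext y
      simp [Multiset.count_cons, List.count_cons, @eq_comm A y]
      try ring
  by_cases hz : z ∈ M
  · obtain ⟨M', rfl⟩ := Multiset.exists_cons_of_mem hz
    convert (h z x M' (by simp at hM; omega)).symm using 2 <;>
    · ext y
      simp [Multiset.count_cons, List.count_cons, @eq_comm A y]
      try ring
  have hnd : ¬ M.Nodup := by
    intro hnd
    have h2 : (x ::ₘ z ::ₘ M).Nodup := by simp [hnd, hx, hz, hxz]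
    have h3 := Finset.card_le_univ (⟨_, h2⟩ : Finset A)
    change (x ::ₘ z ::ₘ M).card ≤ _ at h3
    simp at h3
    omega
  rw [Multiset.nodup_iff_ne_cons_cons] at hnd
  push Not at hnd
  obtain ⟨w, M', rfl⟩ := hnd
  have hc : ∀ y : A, (y ::ₘ M').card + 4 = n := by intro y; simp at hM ⊢; omega
  have e1 := h x w (z ::ₘ M') (hc z)
  have e2 := h w x (z ::ₘ M') (hc z)
  have e3 := h w z (x ::ₘ M') (hc x)
  have e4 := h z w (x ::ₘ M') (hc x)
  trans F (([w, w, w, x] : List A) + (z ::ₘ M'))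
  · convert e2.symm using 2 <;>
    · ext y
      simp [Multiset.count_cons, List.count_cons, @eq_comm A y]
      try ring
  · convert e3 using 2 <;>
    · ext y
      simp [Multiset.count_cons, List.count_cons, @eq_comm A y]
      try ring

/-- Totally symmetric functions of arity at least |A| + 2 are reconstructible. -/
theorem totallySymmetric_reconstructible {A B : Type*} [Fintype A] {k n : ℕ}
    (hcard : Fintype.card A = k) (hk : 2 ≤ k) (hB : Nontrivial B) (hn : k + 2 ≤ n)
    (f : (Fin n → A) → B) (hf : TotallySymmetric f)
    (g : (Fin n → A) → B) (hg : IsReconstruction f g) :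
    FEquiv f g := by
  classical
  subst hcard
  obtain ⟨F, hF⟩ := exists_factor hf
  refine ⟨1, fun b => ?_⟩
  change f b = g b
  obtain ⟨i, j, hij, hb⟩ := Fintype.exists_ne_map_eq_of_card_lt b (by simp; omega)
  obtain ⟨m, hm⟩ := Prel_exists hf hg i j hij
  rw [hm b hb]
  by_cases hmi : m = i
  · subst hmi; simp
  by_cases hmj : m = j
  · subst hmj; rw [← hb]; simp
  have hT : T1 F n := by
    by_contra hT
    refine comb_main (Prel f g) ?_ (Prel_exists hf hg) (Prel_symm hf) ?_ ?_ ?_ i j m hij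
      (Ne.symm hmi) (Ne.symm hmj) hm
    · intro a b c
      have : ({a, b, c} : Finset (Fin n)).card < (Finset.univ : Finset (Fin n)).card := by
        have := Finset.card_le_three (a := a) (b := b) (c := c)
        simp only [Finset.card_univ, Fintype.card_fin]
        omega
      obtain ⟨i, -, hi⟩ := Finset.exists_mem_notMem_of_card_lt_card this
      simp only [Finset.mem_insert, Finset.mem_singleton, not_or] at hi
      exact ⟨i, hi⟩
    · intro i j l u v h1 h2 h3 h4 h5 h6 h7 h8 h9
      exact hT (T1_H1 hF i j l u v h1 h2 h3 h4 h5 h6 h7 h8 h9)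
    · intro i j l m u h1 h2 h3 h4
      exact hT (T1_H2 hF i j l m u h1 h2 h3 h4)
    · intro i j u l m i' j' l' u' v' h1 h2 h3 h4 h5 h6
      exact hT (T1_H3 hF i j u l m i' j' l' u' v' h1 h2 h3 h4 h5 h6)
  let s : Finset (Fin n) := {i, j, m}ᶜ
  have hs : ∀ c : Fin n → A, Finset.univ.val.map c = (([c i, c j, c m] : List A) : Multiset A) + s.val.map c := by
    intro c
    have h1 : (Finset.univ : Finset (Fin n)).val = ({i, j, m} : Finset (Fin n)).val + s.val := by
      rw [← Finset.union_compl ({i, j, m} : Finset (Fin n))]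
      rw [← Finset.disjUnion_eq_union _ _ disjoint_compl_right]
      rfl
    have h2 : ({i, j, m} : Finset (Fin n)).val = (([i, j, m] : List (Fin n)) : Multiset (Fin n)) := by
      rw [Finset.insert_val_of_notMem (by simp [hij, Ne.symm hmi]),
        Finset.insert_val_of_notMem (by simp [Ne.symm hmj])]
      rfl
    rw [h1, h2, Multiset.map_add]
    rfl
  have hsc : (s.val.map b).card + 3 = n := by
    have := congrArg Multiset.card (hs b)
    simp only [Multiset.card_map, Multiset.card_add, Multiset.coe_card, List.length_cons,
      List.length_nil, Finset.card_val, Finset.card_univ, Fintype.card_fin] at this ⊢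
    omega
  have hsu : s.val.map (Function.update b i (b m)) = s.val.map b := by
    apply Multiset.map_congr rfl
    intro t ht
    rw [Function.update_of_ne]
    rintro rfl
    have ht' : t ∈ s := ht
    simp [s] at ht'
  rw [hF, hF, hs, hs (Function.update b i (b m)), hsu, Function.update_self,
    Function.update_of_ne (Ne.symm hij), Function.update_of_ne hmi, hb]
  refine perm_rw F _ (T1_full hn hT (b j) (b m) _ hsc) (List.Perm.refl _) ?_
  rw [List.perm_iff_count]
  intro y
  simp only [List.count_cons, List.count_nil]
  ring
end

section
/- Let A be a finite set with |A| = k and let n > max(k, 3). If f, g : A^n → B are totally symmetric functions with the same deck (i.e., there is a bijection φ of the 2-element subsets of {1,…,n} with f_I ≡ g_{φ(I)} for all I), then f = g. -/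
theorem multiset_map_univ_perm {ι A : Type*} [Fintype ι] (a b : ι → A)
    (h : Finset.univ.val.map a = Finset.univ.val.map b) :
    ∃ σ : Equiv.Perm ι, a = b ∘ σ := by
  classical
  have hc : ∀ x : A, Nonempty ({i // a i = x} ≃ {i // b i = x}) := by
    intro x
    apply Fintype.card_eq.mp
    have h1 := congrArg (Multiset.count x) h
    rw [Multiset.count_map, Multiset.count_map] at h1
    rw [Fintype.card_subtype, Fintype.card_subtype, Finset.card_def, Finset.card_def]
    simpa [Finset.filter_val, eq_comm] using h1
  let e : ∀ x : A, {i // a i = x} ≃ {i // b i = x} := fun x => (hc x).some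
  refine ⟨(Equiv.sigmaFiberEquiv a).symm.trans
    ((Equiv.sigmaCongrRight e).trans (Equiv.sigmaFiberEquiv b)), ?_⟩
  funext i
  exact ((e (a i)) ⟨i, rfl⟩).2.symm

theorem multiset_cons_of_card_pos {A : Type*} (S : Multiset A) (h : 0 < S.card) :
    ∃ x T, S = x ::ₘ T := by
  obtain ⟨x, hx⟩ := Multiset.card_pos_iff_exists_mem.mp h
  obtain ⟨T, hT⟩ := Multiset.exists_cons_of_mem hx
  exact ⟨x, T, hT⟩

open Finset in
theorem delta_map_univ {m : ℕ} (I : Finset (Fin (m+1))) (hI : I.card = 2) :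
    ∃ p : Fin m, (univ : Finset (Fin (m+1))).val.map (deltaMap I hI : Fin (m+1) → Fin m)
      = p ::ₘ (univ : Finset (Fin m)).val := by
  set M := I.max' (two_card_nonempty hI) with hM
  refine ⟨deltaMap I hI M, ?_⟩
  rw [Fin.univ_succAbove m M]
  simp only [Finset.cons_val, Multiset.map_cons, Finset.map_val, Multiset.map_map]
  congr 1
  conv_rhs => rw [← Multiset.map_id (univ : Finset (Fin m)).val]
  apply Multiset.map_congr rfl
  intro t _
  apply Fin.ext
  simp only [Function.comp, Fin.coe_succAboveEmb, id]
  by_cases h : t.castSucc < M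
  · rw [Fin.succAbove_of_castSucc_lt _ _ h]
    have h' : (t : ℕ) < M.val := h
    simp [deltaMap, ← hM, h']
  · rw [Fin.succAbove_of_le_castSucc _ _ (not_lt.mp h)]
    have h' : M.val ≤ (t : ℕ) := not_lt.mp h
    have h1 : ¬ (t : ℕ) + 1 < M.val := by omega
    have h2 : ¬ (t : ℕ) + 1 = M.val := by omega
    simp [deltaMap, ← hM, h1, h2]

open Finset in
theorem exists_fun_of_multiset {A : Type*} {m : ℕ} (x y : A) (Z : Multiset A)
    (hZ : Z.card + 2 = m) (p r : Fin m) (hpr : p ≠ r) :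
    ∃ a : Fin m → A, (univ : Finset (Fin m)).val.map a = x ::ₘ y ::ₘ Z ∧ a p = x ∧ a r = y := by
  subst hZ
  obtain ⟨L, rfl⟩ := Quot.exists_rep Z
  let b : Fin (L.length + 2) → A := fun i => (x :: y :: L).get i
  have hb : (univ : Finset (Fin (L.length + 2))).val.map b = x ::ₘ y ::ₘ (L : Multiset A) := by
    rw [Fin.univ_val_map]
    have : List.ofFn b = x :: y :: L := List.ofFn_get (x :: y :: L)
    rw [this]
    rfl
  let p' : Fin (L.length + 2) := p
  let r' : Fin (L.length + 2) := r
  have hpr' : p' ≠ r' := hpr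
  let r2 := Equiv.swap p' 0 r'
  have hr2 : r2 ≠ 0 := by
    intro h
    apply hpr'
    apply (Equiv.swap p' 0).injective
    rw [Equiv.swap_apply_left]
    exact h.symm
  let σ : Equiv.Perm (Fin (L.length + 2)) := (Equiv.swap p' 0).trans (Equiv.swap r2 1)
  have h1 : σ p' = 0 := by
    simp only [σ, Equiv.trans_apply, Equiv.swap_apply_left]
    exact Equiv.swap_apply_of_ne_of_ne hr2.symm (by simp)
  have h2 : σ r' = 1 := by
    simp only [σ, Equiv.trans_apply]
    exact Equiv.swap_apply_left _ _
  refine ⟨fun t => b (σ t), ?_, ?_, ?_⟩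
  · refine Eq.trans ?_ hb
    conv_rhs => rw [← Multiset.map_univ_val_equiv σ, Multiset.map_map]
    rfl
  · change b (σ p') = x
    rw [h1]; rfl
  · change b (σ r') = y
    rw [h2]; rfl

/-- Totally symmetric functions of arity greater than max(|A|, 3) with the same deck
are equal. -/
theorem totallySymmetric_same_deck_eq {A B : Type*} [Fintype A] {k n : ℕ}
    (hcard : Fintype.card A = k) (hn : max k 3 < n)
    (f g : (Fin n → A) → B) (hf : TotallySymmetric f) (hg : TotallySymmetric g)
    (hdeck : IsReconstruction f g) :
    f = g := by
  obtain ⟨m, rfl⟩ : ∃ m, n = m + 1 := ⟨n - 1, by omega⟩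
  have hk : k < m + 1 := lt_of_le_of_lt (le_max_left _ _) hn
  have hm : 3 < m + 1 := lt_of_le_of_lt (le_max_right _ _) hn
  have sym : ∀ h : (Fin (m+1) → A) → B, TotallySymmetric h → ∀ a b : Fin (m+1) → A,
      Finset.univ.val.map a = Finset.univ.val.map b → h a = h b := by
    intro h hh a b hab
    obtain ⟨σ, rfl⟩ := multiset_map_univ_perm a b hab
    exact hh σ b
  obtain ⟨φ, hφ⟩ := hdeck
  obtain ⟨I, -, hI⟩ : ∃ I ⊆ (Finset.univ : Finset (Fin (m+1))), I.card = 2 :=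
    Finset.exists_subset_card_eq (by simp; omega)
  obtain ⟨σ, hσ⟩ := hφ ⟨I, hI⟩
  obtain ⟨p, hp⟩ := delta_map_univ I hI
  obtain ⟨q, hq⟩ := delta_map_univ (φ ⟨I, hI⟩).1 (φ ⟨I, hI⟩).2
  let τ : Equiv.Perm (Fin m) := σ
  have hτ : (Finset.univ : Finset (Fin m)).val.map τ = (Finset.univ : Finset (Fin m)).val :=
    Multiset.map_univ_val_equiv τ
  -- the key relation between `f` and `g`
  have key : ∀ (a : Fin m → A) (c d : Fin (m+1) → A),
      Finset.univ.val.map c = a p ::ₘ Finset.univ.val.map a →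
      Finset.univ.val.map d = a (τ q) ::ₘ Finset.univ.val.map a → f c = g d := by
    intro a c d hc hd
    have e := hσ a
    have e1 : f c = minor f I hI a := by
      apply sym f hf
      rw [hc, ← Multiset.map_cons, ← hp, Multiset.map_map]
      rfl
    have e2 : g d = minor g (φ ⟨I, hI⟩).1 (φ ⟨I, hI⟩).2 (fun t => a (σ t)) := by
      apply sym g hg
      rw [hd]
      conv_lhs => rw [← hτ]
      rw [← Multiset.map_cons, ← Multiset.map_cons, ← hq, Multiset.map_map, Multiset.map_map]
      rfl
    rw [e1, e2]
    exact e
  have exn : ∀ S : Multiset A, S.card = m + 1 → ∃ c : Fin (m+1) → A,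
      (Finset.univ : Finset (Fin (m+1))).val.map c = S := by
    intro S hS
    obtain ⟨x, S, rfl⟩ := multiset_cons_of_card_pos S (by omega)
    rw [Multiset.card_cons] at hS
    obtain ⟨y, S, rfl⟩ := multiset_cons_of_card_pos S (by omega)
    rw [Multiset.card_cons] at hS
    obtain ⟨a, ha, -⟩ := exists_fun_of_multiset x y S (by omega : S.card + 2 = m + 1)
      ⟨0, by omega⟩ ⟨1, by omega⟩ (by simp)
    exact ⟨a, ha⟩
  funext c
  -- decompose the multiset of values of `c`
  obtain ⟨i, j, hij, hcij⟩ : ∃ i j, i ≠ j ∧ c i = c j :=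
    Fintype.exists_ne_map_eq_of_card_lt c (by simp [hcard]; omega)
  have hci : ∃ W : Multiset A, (Finset.univ : Finset (Fin (m+1))).val.map c
      = c i ::ₘ c i ::ₘ W := by
    classical
    refine ⟨((Finset.univ.erase i).erase j).val.map c, ?_⟩
    conv_rhs => arg 2; rw [hcij]
    rw [← Multiset.map_cons, ← Multiset.map_cons, ← Finset.insert_val_of_notMem (by simp),
      Finset.insert_erase (by simp [hij.symm]), ← Finset.insert_val_of_notMem (by simp),
      Finset.insert_erase (by simp)]
  obtain ⟨W, hW⟩ := hci
  have hWc := congrArg Multiset.card hW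
  simp only [Multiset.card_map, Finset.card_val, Finset.card_univ, Fintype.card_fin,
    Multiset.card_cons] at hWc
  obtain ⟨y, W, rfl⟩ := multiset_cons_of_card_pos W (by omega)
  rw [Multiset.card_cons] at hWc
  obtain ⟨z, W, rfl⟩ := multiset_cons_of_card_pos W (by omega)
  rw [Multiset.card_cons] at hWc
  generalize c i = x at hW
  by_cases hpr : p = τ q
  · obtain ⟨r, hr⟩ : ∃ r : Fin m, p ≠ r := by
      haveI : Nontrivial (Fin m) := Fin.nontrivial_iff_two_le.mpr (by omega)
      obtain ⟨r, hr⟩ := exists_ne p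
      exact ⟨r, hr.symm⟩
    obtain ⟨a, ha, hap, -⟩ := exists_fun_of_multiset x y (z ::ₘ W)
      (by rw [Multiset.card_cons]; omega) p r hr
    apply key a c c
    · rw [hap, ha, hW]
    · rw [← hpr, hap, ha, hW]
  · have step : ∀ (u v w : A) (c d : Fin (m+1) → A),
        Finset.univ.val.map c = u ::ₘ u ::ₘ v ::ₘ w ::ₘ W →
        Finset.univ.val.map d = v ::ₘ u ::ₘ v ::ₘ w ::ₘ W → f c = g d := by
      intro u v w c d hc hd
      obtain ⟨a, ha, hap, haq⟩ := exists_fun_of_multiset u v (w ::ₘ W)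
        (by rw [Multiset.card_cons]; omega) p (τ q) hpr
      apply key a c d
      · rw [hap, ha, hc]
      · rw [haq, ha, hd]
    obtain ⟨d1, hd1⟩ := exn (y ::ₘ x ::ₘ y ::ₘ z ::ₘ W)
      (by simp only [Multiset.card_cons]; omega)
    obtain ⟨d2, hd2⟩ := exn (z ::ₘ x ::ₘ y ::ₘ z ::ₘ W)
      (by simp only [Multiset.card_cons]; omega)
    have s1 : f c = g d1 := step x y z c d1 hW hd1
    have s2 : f d2 = g d1 := by
      apply step z y x
      · rw [hd2]; simp only [← Multiset.singleton_add]; abel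
      · rw [hd1]; simp only [← Multiset.singleton_add]; abel
    have s3 : f d2 = g c := by
      apply step z x y
      · rw [hd2]; simp only [← Multiset.singleton_add]; abel
      · rw [hW]; simp only [← Multiset.singleton_add]; abel
    rw [s1, ← s2, s3]
end

section
/- Let A be a finite set with |A| = k ≥ 2, let B be a set with at least two elements, and let n ≥ k + 2. If f : A^n → B is determined by (pr, supp), then f is reconstructible: every reconstruction of f is equivalent to f. -/
/-- A function is determined by `(pr, supp)` if `f a = f* (a_i, supp a)` for some index `i`
and some map `f* : A × 𝒫(A) → B`. -/
def DeterminedByPrSupp {A B : Type*} {n : ℕ} (f : (Fin n → A) → B) : Prop :=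
  ∃ (i : Fin n) (fstar : A × Set A → B), ∀ a : Fin n → A, f a = fstar (a i, Set.range a)

theorem aux_delta {n : ℕ} (i j : Fin n) (hij : i < j) (I : Finset (Fin n)) (hI : I.card = 2)
    (hIe : I = {i, j}) : ∃ s : Fin (n - 1) → Fin n,
      (∀ t, deltaMap I hI (s t) = t) ∧
      (∀ t, s (deltaMap I hI t) = t ∨ (t = j ∧ s (deltaMap I hI t) = i)) := by
  have hmax : I.max' (two_card_nonempty hI) = j := by
    apply le_antisymm
    · apply Finset.max'_le
      intro y hy
      subst hIe
      simp at hy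
      rcases hy with rfl | rfl
      · exact hij.le
      · exact le_rfl
    · apply Finset.le_max'
      simp [hIe]
  have hmin : I.min' (two_card_nonempty hI) = i := by
    apply le_antisymm
    · apply Finset.min'_le
      simp [hIe]
    · apply Finset.le_min'
      intro y hy
      subst hIe
      simp at hy
      rcases hy with rfl | rfl
      · exact le_rfl
      · exact hij.le
  have hij' : i.val < j.val := hij
  have hj := j.isLt
  have hval : ∀ t, (deltaMap I hI t).val =
      if t.val < j.val then t.val else if t.val = j.val then i.val else t.val - 1 := by
    intro t
    unfold deltaMap
    simp only [hmax, hmin]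
    split_ifs <;> rfl
  refine ⟨fun t => if t.val < j.val then ⟨t.val, by omega⟩ else ⟨t.val + 1, by omega⟩, ?_, ?_⟩
  · intro t
    apply Fin.ext
    rw [hval]
    by_cases h : t.val < j.val
    · simp [h]
    · have h1 : ¬ (t.val + 1 < j.val) := by omega
      have h2 : ¬ (t.val + 1 = j.val) := by omega
      simp [h, h1, h2]
  · intro t
    by_cases h : t = j
    · right
      refine ⟨h, ?_⟩
      apply Fin.ext
      have := hval t
      simp [h] at this ⊢
      simp [this, hij']
    · left
      have h' : t.val ≠ j.val := fun e => h (Fin.ext e)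
      apply Fin.ext
      have := hval t
      by_cases h2 : t.val < j.val
      · simp [h2] at this ⊢
        simp [this, h2]
      · simp [h2, h'] at this ⊢
        have h3 : ¬ (t.val - 1 < j.val) := by omega
        simp [this, h3]
        omega

theorem aux_Q_lt {A B : Type*} {n : ℕ} (f g : (Fin n → A) → B) (i0 : Fin n)
    (F : A × Set A → B) (hf : ∀ a : Fin n → A, f a = F (a i0, Set.range a))
    (hg : IsReconstruction f g) (i j : Fin n) (hij : i < j) :
    ∃ q : Fin n, ∀ a : Fin n → A, a i = a j → g a = F (a q, Set.range a) := by
  obtain ⟨φ, hφ⟩ := hg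
  have hcard : ({i, j} : Finset (Fin n)).card = 2 := Finset.card_pair hij.ne
  obtain ⟨⟨I', hI'⟩, hI⟩ := φ.surjective ⟨{i, j}, hcard⟩
  have hE : FEquiv (minor f I' hI') (minor g {i, j} hcard) := by
    have h := hφ ⟨I', hI'⟩
    have gen : ∀ K : {I : Finset (Fin n) // I.card = 2}, φ ⟨I', hI'⟩ = K →
        FEquiv (minor f I' hI') (minor g K.1 K.2) := by
      rintro K rfl
      exact h
    exact gen _ hI
  obtain ⟨σ, hσ⟩ := hE
  obtain ⟨s, hs1, hs2⟩ := aux_delta i j hij {i, j} hcard rfl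
  obtain ⟨i', j', hne, hI'e⟩ := Finset.card_eq_two.mp hI'
  have hsurj : Function.Surjective (deltaMap I' hI') := by
    rcases lt_or_gt_of_ne hne with h | h
    · obtain ⟨s', h1, -⟩ := aux_delta i' j' h I' hI' hI'e
      exact fun t => ⟨s' t, h1 t⟩
    · obtain ⟨s', h1, -⟩ := aux_delta j' i' h I' hI' (by rw [hI'e, Finset.pair_comm])
      exact fun t => ⟨s' t, h1 t⟩
  refine ⟨s (σ.symm (deltaMap I' hI' i0)), fun a ha => ?_⟩
  have hfac : ∀ t, a (s (deltaMap {i, j} hcard t)) = a t := by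
    intro t
    rcases hs2 t with h | ⟨h1, h2⟩
    · rw [h]
    · rw [h2, h1, ha]
  have key := hσ (fun t => a (s (σ.symm t)))
  simp only [minor, Equiv.symm_apply_apply, hfac, hf] at key
  rw [← key]
  congr 2
  ext z
  constructor
  · rintro ⟨t, rfl⟩
    exact ⟨_, rfl⟩
  · rintro ⟨t, rfl⟩
    obtain ⟨u, hu⟩ := hsurj (σ (deltaMap {i, j} hcard t))
    exact ⟨u, by simp [hu, hfac]⟩

theorem aux_Q {A B : Type*} {n : ℕ} (f g : (Fin n → A) → B) (i0 : Fin n)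
    (F : A × Set A → B) (hf : ∀ a : Fin n → A, f a = F (a i0, Set.range a))
    (hg : IsReconstruction f g) (i j : Fin n) (hij : i ≠ j) :
    ∃ q : Fin n, ∀ a : Fin n → A, a i = a j → g a = F (a q, Set.range a) := by
  rcases lt_or_gt_of_ne hij with h | h
  · exact aux_Q_lt f g i0 F hf hg i j h
  · obtain ⟨q, hq⟩ := aux_Q_lt f g i0 F hf hg j i h
    exact ⟨q, fun a ha => hq a ha.symm⟩

theorem aux_emb {A T : Type*} (e : A ↪ T) (x y : A) (hxy : x ≠ y) (p q : T) (hpq : p ≠ q) :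
    ∃ e' : A ↪ T, e' x = p ∧ e' y = q := by
  classical
  let e1 : A ↪ T := e.trans (Equiv.swap (e x) p).toEmbedding
  have h1 : e1 x = p := by simp [e1]
  have h2 : e1 y ≠ p := fun h => hxy (e1.injective (h1.trans h.symm))
  refine ⟨e1.trans (Equiv.swap (e1 y) q).toEmbedding, ?_, ?_⟩
  · simp [h1, Equiv.swap_apply_of_ne_of_ne h2.symm hpq]
  · simp

theorem aux_tuple {A : Type*} [Fintype A] {n : ℕ} (hn : Fintype.card A + 2 ≤ n)
    (S : Set A) (x y : A) (hx : x ∈ S) (hy : y ∈ S) (hxy : x ≠ y)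
    (m : Fin n → Fin n) (u v : Fin n) (hm : ∀ t, t ≠ u → t ≠ v → m t = t)
    (p q : Fin n) (hpq : m p ≠ m q) :
    ∃ a : Fin n → A, a p = x ∧ a q = y ∧ Set.range a = S ∧ ∀ s t, m s = m t → a s = a t := by
  classical
  have hc : Fintype.card A ≤ Fintype.card (Set.range m) := by
    rw [← Set.toFinset_card]
    have hsub : (Finset.univ \ {u, v} : Finset (Fin n)) ⊆ (Set.range m).toFinset := by
      intro t ht
      simp at ht
      simp only [Set.mem_toFinset]
      exact ⟨t, hm t ht.1 ht.2⟩
    have h1 := Finset.card_le_card hsub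
    have h2 := Finset.le_card_sdiff ({u, v} : Finset (Fin n)) Finset.univ
    have h3 : ({u, v} : Finset (Fin n)).card ≤ 2 := Finset.card_le_two
    simp only [Finset.card_univ, Fintype.card_fin] at h2
    omega
  obtain ⟨e0⟩ := Function.Embedding.nonempty_of_card_le hc
  obtain ⟨e, hex, hey⟩ := aux_emb e0 x y hxy ⟨m p, p, rfl⟩ ⟨m q, q, rfl⟩
    (fun h => hpq (congrArg Subtype.val h))
  haveI : Nonempty A := ⟨x⟩
  let c : Set.range m → A := fun t =>
    if Function.invFun e t ∈ S then Function.invFun e t else x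
  have hinv : ∀ s, Function.invFun e (e s) = s := Function.leftInverse_invFun e.injective
  have hce : ∀ s ∈ S, c (e s) = s := by
    intro s hs
    simp [c, hinv, hs]
  refine ⟨fun t => c ⟨m t, t, rfl⟩, ?_, ?_, ?_, ?_⟩
  · change c ⟨m p, p, rfl⟩ = x
    rw [← hex, hce x hx]
  · change c ⟨m q, q, rfl⟩ = y
    rw [← hey, hce y hy]
  · ext z
    constructor
    · rintro ⟨t, rfl⟩
      change c _ ∈ S
      simp only [c]
      split_ifs with h
      · exact h
      · exact hx
    · intro hz
      obtain ⟨t, ht⟩ := (e z).2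
      refine ⟨t, ?_⟩
      have : (⟨m t, t, rfl⟩ : Set.range m) = e z := Subtype.ext ht
      change c ⟨m t, t, rfl⟩ = z
      rw [this, hce z hz]
  · intro s t hst
    have : (⟨m s, s, rfl⟩ : Set.range m) = ⟨m t, t, rfl⟩ := Subtype.ext hst
    change c _ = c _
    rw [this]

/-- merging `j` into `i` -/
def auxMerge {n : ℕ} (i j t : Fin n) : Fin n := if t = j then i else t

theorem aux_compat {A B : Type*} [Fintype A] {n : ℕ} (hn : Fintype.card A + 2 ≤ n)
    (g : (Fin n → A) → B) (F : A × Set A → B)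
    (S : Set A) (x y : A) (hx : x ∈ S) (hy : y ∈ S) (hF : F (x, S) ≠ F (y, S))
    (i1 i2 j1 j2 p q : Fin n)
    (hp : ∀ a : Fin n → A, a i1 = a i2 → g a = F (a p, Set.range a))
    (hq : ∀ a : Fin n → A, a j1 = a j2 → g a = F (a q, Set.range a)) :
    auxMerge (auxMerge i1 i2 j1) (auxMerge i1 i2 j2) (auxMerge i1 i2 p) =
    auxMerge (auxMerge i1 i2 j1) (auxMerge i1 i2 j2) (auxMerge i1 i2 q) := by
  by_contra hne
  obtain ⟨a, h1, h2, h3, h4⟩ := aux_tuple hn S x y hx hy (fun h => hF (by rw [h]))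
    (fun t => auxMerge (auxMerge i1 i2 j1) (auxMerge i1 i2 j2) (auxMerge i1 i2 t))
    i2 (auxMerge i1 i2 j2) (by intro t h h'; simp only [auxMerge] at *; grind) p q hne
  have e1 := hp a (h4 _ _ (by simp only [auxMerge]; grind))
  have e2 := hq a (h4 _ _ (by simp only [auxMerge]; grind))
  rw [h1, h3] at e1
  rw [h2, h3] at e2
  exact hF (e1.symm.trans e2)

theorem aux_avoid {n : ℕ} (hn : 4 ≤ n) (p q : Fin n) :
    ∃ i j : Fin n, i ≠ j ∧ i ≠ p ∧ i ≠ q ∧ j ≠ p ∧ j ≠ q := by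
  have h2 := Finset.le_card_sdiff ({p, q} : Finset (Fin n)) Finset.univ
  have h3 : ({p, q} : Finset (Fin n)).card ≤ 2 := Finset.card_le_two
  simp only [Finset.card_univ, Fintype.card_fin] at h2
  obtain ⟨i, hi, j, hj, hij⟩ :=
    Finset.one_lt_card.mp (show 1 < (Finset.univ \ {p, q} : Finset (Fin n)).card by omega)
  simp at hi hj
  exact ⟨i, j, hij, hi.1, hi.2, hj.1, hj.2⟩

theorem aux_global {A B : Type*} [Fintype A] {n : ℕ} (hn : Fintype.card A + 2 ≤ n) (hn4 : 4 ≤ n)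
    (g : (Fin n → A) → B) (F : A × Set A → B)
    (S : Set A) (x y : A) (hx : x ∈ S) (hy : y ∈ S) (hF : F (x, S) ≠ F (y, S))
    (hQ : ∀ i j : Fin n, i ≠ j →
      ∃ q : Fin n, ∀ a : Fin n → A, a i = a j → g a = F (a q, Set.range a)) :
    ∃ q : Fin n, ∀ i j : Fin n, i ≠ j →
      ∀ a : Fin n → A, a i = a j → g a = F (a q, Set.range a) := by
  have hC := aux_compat hn g F S x y hx hy hF
  by_cases hA : ∃ i j q : Fin n, i ≠ j ∧ q ≠ i ∧ q ≠ j ∧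
      ∀ a : Fin n → A, a i = a j → g a = F (a q, Set.range a)
  · obtain ⟨i, j, q, hij, hqi, hqj, hq⟩ := hA
    have h1 : ∀ i' j' : Fin n, i' ≠ j' → q ≠ i' → q ≠ j' →
        ∀ a : Fin n → A, a i' = a j' → g a = F (a q, Set.range a) := by
      intro i' j' hne h1 h2
      obtain ⟨r, hr⟩ := hQ i' j' hne
      have h := hC i j i' j' q r hq hr
      have : r = q := by
        simp only [auxMerge] at h
        grind
      exact this ▸ hr
    have h2 : ∀ j' : Fin n, q ≠ j' →
        ∀ a : Fin n → A, a q = a j' → g a = F (a q, Set.range a) := by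
      intro j' hne
      obtain ⟨i1, i2, h12, h1q, h1j, h2q, h2j⟩ := aux_avoid hn4 q j'
      obtain ⟨r, hr⟩ := hQ q j' hne
      have h := hC i1 i2 q j' q r (h1 i1 i2 h12 h1q.symm h2q.symm) hr
      have h' : r = q ∨ r = j' := by
        simp only [auxMerge] at h
        grind
      intro a ha
      rw [hr a ha]
      rcases h' with rfl | rfl
      · rfl
      · rw [ha]
    refine ⟨q, fun i' j' hne a ha => ?_⟩
    by_cases hi : q = i'
    · subst hi
      exact h2 j' hne a ha
    · by_cases hj : q = j'
      · subst hj
        exact h2 i' hne.symm a ha.symm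
      · exact h1 i' j' hne hi hj a ha
  · exfalso
    push Not at hA
    let i : Fin n := ⟨0, by omega⟩
    let j : Fin n := ⟨1, by omega⟩
    have hij : i ≠ j := by simp [i, j]
    obtain ⟨i', j', hne, h1, h2, h3, h4⟩ := aux_avoid hn4 i j
    obtain ⟨p, hp⟩ := hQ i j hij
    obtain ⟨q, hq⟩ := hQ i' j' hne
    have hp' : p = i ∨ p = j := by
      by_contra hcon
      push Not at hcon
      obtain ⟨a, ha, hb⟩ := hA i j p hij hcon.1 hcon.2
      exact hb (hp a ha)
    have hq' : q = i' ∨ q = j' := by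
      by_contra hcon
      push Not at hcon
      obtain ⟨a, ha, hb⟩ := hA i' j' q hne hcon.1 hcon.2
      exact hb (hq a ha)
    have h := hC i j i' j' p q hp hq
    simp only [auxMerge] at h
    clear_value i j
    clear hC hQ hA hp hq
    grind

/-- Functions determined by `(pr, supp)` of arity at least |A| + 2 are reconstructible. -/
theorem prSupp_reconstructible {A B : Type*} [Fintype A] {k n : ℕ}
    (hcard : Fintype.card A = k) (hk : 2 ≤ k) (hB : Nontrivial B) (hn : k + 2 ≤ n)
    (f : (Fin n → A) → B) (hf : DeterminedByPrSupp f)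
    (g : (Fin n → A) → B) (hg : IsReconstruction f g) :
    FEquiv f g := by
  obtain ⟨i0, F, hfF⟩ := hf
  subst hcard
  have hQ := aux_Q f g i0 F hfF hg
  have hrep : ∀ a : Fin n → A, ∃ i j, i ≠ j ∧ a i = a j := by
    intro a
    obtain ⟨i, j, h1, h2⟩ := Fintype.exists_ne_map_eq_of_card_lt a
      (by rw [Fintype.card_fin]; omega)
    exact ⟨i, j, h1, h2⟩
  by_cases hsym : ∀ (S : Set A) (x y : A), x ∈ S → y ∈ S → F (x, S) = F (y, S)
  · refine ⟨1, fun a => ?_⟩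
    obtain ⟨i, j, hij, ha⟩ := hrep a
    obtain ⟨q, hq⟩ := hQ i j hij
    simp only [Equiv.Perm.one_apply]
    rw [hfF, hq a ha]
    exact hsym _ _ _ ⟨_, rfl⟩ ⟨_, rfl⟩
  · push Not at hsym
    obtain ⟨S, x, y, hx, hy, hF⟩ := hsym
    obtain ⟨q, hq⟩ := aux_global hn (by omega) g F S x y hx hy hF hQ
    refine ⟨Equiv.swap i0 q, fun a => ?_⟩
    obtain ⟨i, j, hij, ha⟩ := hrep (fun t => a (Equiv.swap i0 q t))
    rw [hfF, hq i j hij _ ha, Equiv.swap_apply_right]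
    congr 2
    exact ((Equiv.swap i0 q).surjective.range_comp a).symm
end

section
/- Let A be a finite set with at least two elements, let B be a set with at least two elements, and let n > |A|. If f : A^n → B is determined by supp, then f is reconstructible: every reconstruction of f is equivalent to f. -/
/-- A function is determined by `supp` if it factors through `a ↦ {a_1, …, a_n}`. -/
def DeterminedBySupp {A B : Type*} {n : ℕ} (f : (Fin n → A) → B) : Prop :=
  ∃ fstar : Set A → B, ∀ a : Fin n → A, f a = fstar (Set.range a)

theorem deltaMap_eq_section {n : ℕ} (I : Finset (Fin n)) (hI : I.card = 2) :
    ∃ s : Fin (n - 1) → Fin n, (∀ u, deltaMap I hI (s u) = u) ∧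
      ∀ t, s (deltaMap I hI t) = t ∨
        (s (deltaMap I hI t) = I.min' (two_card_nonempty hI) ∧
          t = I.max' (two_card_nonempty hI)) := by
  have h := min'_lt_max'_two hI
  set M := I.max' (two_card_nonempty hI) with hM
  set m := I.min' (two_card_nonempty hI) with hm
  refine ⟨fun u => if (u : ℕ) < M.val then ⟨u, by omega⟩ else ⟨u + 1, by omega⟩, ?_, ?_⟩
  · intro u
    unfold deltaMap
    simp only [← hM, ← hm]
    apply Fin.ext
    by_cases hu : (u : ℕ) < M.val
    · simp [hu]
    · have h1 : ¬ (u : ℕ) + 1 < M.val := by omega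
      have h2 : ¬ (u : ℕ) + 1 = M.val := by omega
      simp [hu, h1, h2]
  · intro t
    unfold deltaMap
    simp only [← hM, ← hm, Fin.ext_iff]
    split_ifs <;> simp_all <;> omega

theorem range_comp_deltaMap {A : Type*} {n : ℕ} (I : Finset (Fin n)) (hI : I.card = 2)
    (a : Fin (n - 1) → A) : Set.range (fun t => a (deltaMap I hI t)) = Set.range a := by
  obtain ⟨s, hs, -⟩ := deltaMap_eq_section I hI
  have hsurj : Function.Surjective (deltaMap I hI) := fun u => ⟨s u, hs u⟩
  exact hsurj.range_comp a

/-- Functions determined by `supp` of arity greater than |A| are reconstructible. -/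
theorem supp_reconstructible {A B : Type*} [Fintype A]
    (hA : 2 ≤ Fintype.card A) (hB : Nontrivial B) {n : ℕ} (hn : Fintype.card A < n)
    (f : (Fin n → A) → B) (hf : DeterminedBySupp f)
    (g : (Fin n → A) → B) (hg : IsReconstruction f g) :
    FEquiv f g := by
  classical
  obtain ⟨fs, hfs⟩ := hf
  obtain ⟨φ, hφ⟩ := hg
  refine ⟨Equiv.refl _, fun b => ?_⟩
  have hinj : ¬ Function.Injective b := fun hb => by
    have := Fintype.card_le_of_injective b hb
    simp at this
    omega
  obtain ⟨i, j, hij, hne⟩ : ∃ i j, b i = b j ∧ i ≠ j := by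
    simpa [Function.Injective] using hinj
  have hJ : ({i, j} : Finset (Fin n)).card = 2 := Finset.card_pair hne
  have hconst : ∀ t ∈ ({i, j} : Finset (Fin n)), b t = b i := by
    intro t ht
    rcases Finset.mem_insert.mp ht with rfl | ht
    · rfl
    · rw [Finset.mem_singleton.mp ht, hij]
  generalize hJdef : ({i, j} : Finset (Fin n)) = J at hJ hconst
  obtain ⟨s, hs, hst⟩ := deltaMap_eq_section J hJ
  have hb : (fun t => b (s (deltaMap J hJ t))) = b := by
    funext t
    rcases hst t with h | ⟨h1, h2⟩
    · rw [h]
    · rw [h1, h2, hconst _ (Finset.min'_mem _ _), hconst _ (Finset.max'_mem _ _)]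
  obtain ⟨I, hI⟩ := φ.surjective ⟨J, hJ⟩
  obtain ⟨σ, hσ⟩ := hφ I
  simp only [hI] at hσ
  have key := hσ (fun u => b (s (σ.symm u)))
  simp only [minor, Equiv.symm_apply_apply, hb] at key
  rw [hfs, range_comp_deltaMap I.1 I.2 (fun u => b (s (σ.symm u)))] at key
  have hr : Set.range (fun u => b (s (σ.symm u))) = Set.range b := by
    have h1 : Set.range (fun u => b (s (σ.symm u))) = Set.range (fun u => b (s u)) :=
      σ.symm.surjective.range_comp (fun u => b (s u))
    rw [h1, ← range_comp_deltaMap J hJ (fun u => b (s u)), hb]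
  rw [hr] at key
  rw [hfs, key]
  rfl
end

section
/- Let A be a finite set with at least two elements, let B be a set with at least two elements, and let n > max(|A|, 3). If f : A^n → B is determined by oddsupp, then f is reconstructible: every reconstruction of f is equivalent to f. -/
/-- `oddsupp a` is the set of elements occurring an odd number of times in the tuple `a`. -/
def oddsupp {A : Type*} {n : ℕ} (a : Fin n → A) : Set A :=
  {x | Odd (Nat.card {i : Fin n // a i = x})}

/-- A function is determined by `oddsupp` if it factors through `oddsupp`. -/
def DeterminedByOddsupp {A B : Type*} {n : ℕ} (f : (Fin n → A) → B) : Prop :=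
  ∃ fstar : Set A → B, ∀ a : Fin n → A, f a = fstar (oddsupp a)

/-- invariance under replacing a pair of equal entries -/
def PairInv {A B : Type*} {n : ℕ} (f : (Fin n → A) → B) : Prop :=
  ∀ (p q : Fin n) (x y : Fin n → A), p ≠ q → x p = x q → y p = y q →
    (∀ t, t ≠ p → t ≠ q → x t = y t) → f x = f y

/-- the essential-argument property -/
def Ess {A B : Type*} {n : ℕ} (f : (Fin n → A) → B) : Prop :=
  ∀ p q s : Fin n, p ≠ q → p ≠ s → q ≠ s → ∃ (x : Fin n → A) (b : A), x p = x q ∧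
    f x ≠ f (Function.update x s b)

/-- identifying `i, j` in `g` gives `f` with `k` cancelled -/
def Dump {A B : Type*} {n : ℕ} (f g : (Fin n → A) → B) (i j k : Fin n) : Prop :=
  k ≠ i ∧ ∀ x : Fin n → A, x i = x j → g x = f (Function.update x k (x i))

theorem oddsupp_card {A : Type*} [DecidableEq A] {n : ℕ} (a : Fin n → A) (c : A) :
    c ∈ oddsupp a ↔ (∑ t, (if a t = c then (1 : ZMod 2) else 0)) = 1 := by
  unfold oddsupp
  simp only [Set.mem_ofPred_eq, Finset.sum_boole, Nat.card_eq_fintype_card, Fintype.card_subtype]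
  rw [ZMod.natCast_eq_one_iff_odd]

theorem pairInv_of_det {A B : Type*} {n : ℕ} {f : (Fin n → A) → B}
    (hf : DeterminedByOddsupp f) : PairInv f := by
  classical
  obtain ⟨F, hF⟩ := hf
  intro p q x y hpq hx hy h
  rw [hF, hF]
  congr 1
  ext c
  rw [oddsupp_card, oddsupp_card]
  have key : ∀ z : Fin n → A, z p = z q → (∑ t, (if z t = c then (1 : ZMod 2) else 0))
      = ∑ t ∈ (Finset.univ.erase p).erase q, (if z t = c then (1 : ZMod 2) else 0) := by
    intro z hz
    rw [← Finset.add_sum_erase Finset.univ _ (Finset.mem_univ p),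
      ← Finset.add_sum_erase (Finset.univ.erase p) _
        (Finset.mem_erase.2 ⟨hpq.symm, Finset.mem_univ q⟩), hz, ← add_assoc,
      CharTwo.add_self_eq_zero, zero_add]
  rw [key x hx, key y hy]
  have : ∑ t ∈ (Finset.univ.erase p).erase q, (if x t = c then (1 : ZMod 2) else 0)
      = ∑ t ∈ (Finset.univ.erase p).erase q, (if y t = c then (1 : ZMod 2) else 0) := by
    apply Finset.sum_congr rfl
    intro t ht
    simp only [Finset.mem_erase, Finset.mem_univ, and_true] at ht
    rw [h t ht.2 ht.1]
  rw [this]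

theorem symm_of_det {A B : Type*} {n : ℕ} {f : (Fin n → A) → B}
    (hf : DeterminedByOddsupp f) : TotallySymmetric f := by
  classical
  obtain ⟨F, hF⟩ := hf
  intro σ a
  rw [hF, hF]
  congr 1
  ext c
  rw [oddsupp_card, oddsupp_card]
  rw [Equiv.sum_comp σ (fun t => if a t = c then (1 : ZMod 2) else 0)]

theorem ruleA {A B : Type*} {n : ℕ} {f g : (Fin n → A) → B} (hP : PairInv f) (hE : Ess f)
    {i j k l m : Fin n} (hij : i ≠ j) (hil : i ≠ l) (hjl : j ≠ l)
    (hki : k ≠ i) (hkj : k ≠ j) (hkl : k ≠ l) (h1 : Dump f g i j k) (h2 : Dump f g i l m)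
    (hm : m = j ∨ m = l) : False := by
  obtain ⟨m', hm'⟩ : ∃ m', (m = j ∧ m' = l) ∨ (m = l ∧ m' = j) := by
    rcases hm with h | h
    · exact ⟨l, Or.inl ⟨h, rfl⟩⟩
    · exact ⟨j, Or.inr ⟨h, rfl⟩⟩
  have him : i ≠ m := by grind
  have hkm : k ≠ m := by grind
  have hkm' : k ≠ m' := by grind
  have him' : i ≠ m' := by grind
  have hmm' : m ≠ m' := by grind
  obtain ⟨x, b, hx, hne⟩ := hE i m k him hki.symm hkm.symm
  apply hne
  set y := Function.update (Function.update x i (x m')) m (x m') with hy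
  have e1 : f x = f y := hP i m x y him hx (by grind [Function.update_apply])
    (by grind [Function.update_apply])
  have e2 : f (Function.update x k b) = f (Function.update y k b) :=
    hP i m _ _ him (by grind [Function.update_apply]) (by grind [Function.update_apply])
    (by grind [Function.update_apply])
  have yi : y i = x m' := by grind [Function.update_apply]
  have ym : y m = x m' := by grind [Function.update_apply]
  have ym' : y m' = x m' := by grind [Function.update_apply]
  have yj : y i = y j := by grind
  have yl : y i = y l := by grind
  rw [e1, e2]
  have a1 := h1.2 y yj
  have a2 := h1.2 (Function.update y k b) (by grind [Function.update_apply])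
  have a3 := h2.2 y yl
  have a4 := h2.2 (Function.update y k b) (by grind [Function.update_apply])
  have b3 : Function.update y m (y i) = y := by
    funext t; grind [Function.update_apply]
  have b4 : Function.update (Function.update y k b) m (Function.update y k b i)
      = Function.update y k b := by
    funext t; grind [Function.update_apply]
  have b2 : Function.update (Function.update y k b) k (Function.update y k b i)
      = Function.update y k (y i) := by
    funext t; grind [Function.update_apply]
  rw [b3] at a3
  rw [b4] at a4
  rw [b2] at a2
  rw [← a3, ← a4, a1, a2]

theorem ruleB {A B : Type*} {n : ℕ} {f g : (Fin n → A) → B} (hP : PairInv f) (hE : Ess f)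
    {i j k l m : Fin n} (hij : i ≠ j) (hik : i ≠ k) (hil : i ≠ l) (hjk : j ≠ k) (hjl : j ≠ l)
    (hkl : k ≠ l) (h1 : Dump f g i j k) (h2 : Dump f g k l m) (hmi : m ≠ i) (hmj : m ≠ j) :
    False := by
  obtain ⟨x, b, hx, hne⟩ := hE i k j hik hij hjk.symm
  apply hne
  have hmk := h2.1
  set y := Function.update (Function.update x i (x j)) k (x l) with hy
  set y' := Function.update (Function.update y i b) j b with hy'
  have yi : y i = x j := by grind [Function.update_apply]
  have yj : y j = x j := by grind [Function.update_apply]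
  have yk : y k = x l := by grind [Function.update_apply]
  have yl : y l = x l := by grind [Function.update_apply]
  have yo : ∀ t, t ≠ i → t ≠ k → y t = x t := by grind [Function.update_apply]
  have yi' : y' i = b := by grind [Function.update_apply]
  have yj' : y' j = b := by grind [Function.update_apply]
  have yo' : ∀ t, t ≠ i → t ≠ j → y' t = y t := by grind [Function.update_apply]
  clear_value y y'
  have a1 := h1.2 y (by grind)
  have a2 := h1.2 y' (by grind)
  have a3 := h2.2 y (by grind)
  have a4 := h2.2 y' (by grind)
  have c1 : f x = f (Function.update y k (y i)) :=
    hP i k _ _ hik hx (by grind [Function.update_apply]) (by grind [Function.update_apply])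
  have c2 : f (Function.update x j b) = f (Function.update y' k (y' i)) :=
    hP i k _ _ hik (by grind [Function.update_apply]) (by grind [Function.update_apply])
      (by grind [Function.update_apply])
  have c3 : f (Function.update y m (y k)) = f (Function.update y' m (y' k)) :=
    hP i j _ _ hij (by grind [Function.update_apply]) (by grind [Function.update_apply])
      (by grind [Function.update_apply])
  rw [c1, c2, ← a1, ← a2, a3, a4, c3]

theorem Dump.swap {A B : Type*} {n : ℕ} {f g : (Fin n → A) → B} {i j k : Fin n}
    (h : Dump f g i j k) (hk : k ≠ j) : Dump f g j i k :=
  ⟨hk, fun x hx => by rw [h.2 x hx.symm, hx]⟩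

theorem no_ext_aux {A B : Type*} {n : ℕ} {f g : (Fin n → A) → B} (hP : PairInv f) (hE : Ess f)
    (hD : ∀ i j : Fin n, i ≠ j → ∃ k, Dump f g i j k)
    {i j k l : Fin n} (hij : i ≠ j) (hik : i ≠ k) (hil : i ≠ l) (hjk : j ≠ k) (hjl : j ≠ l)
    (hkl : k ≠ l) (h1 : Dump f g i j k) (h2 : Dump f g k l j) : False := by
  have h1' := h1.swap hjk.symm
  have h2' := h2.swap hjl
  -- the pair j l
  have h3 : Dump f g j l k := by
    obtain ⟨m, hm⟩ := hD j l hjl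
    have m1 : m ≠ l := fun h => ruleA hP hE hij.symm hjl hil hjk.symm hik.symm hkl h1' hm
      (Or.inr h)
    have m2 := hm.1
    by_cases m3 : m = k
    · exact m3 ▸ hm
    · exact (ruleA hP hE hjl.symm hkl.symm hjk m1 m2 m3 (hm.swap m1) h2' (Or.inl rfl)).elim
  obtain ⟨m, hm⟩ := hD i l hil
  have m1 := hm.1
  have m2 : m ≠ l := fun h => ruleA hP hE hij hil hjl hik.symm hjk.symm hkl h1 hm (Or.inr h)
  have m3 : m ≠ j := fun h => ruleA hP hE hij hil hjl hik.symm hjk.symm hkl h1 hm (Or.inl h)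
  have m4 : m ≠ k := fun h => ruleA hP hE hkl.symm hil.symm hik.symm hjl hjk hij.symm h2'
    (hm.swap m2) (Or.inl h)
  obtain ⟨q, hq⟩ := hD m j m3
  have hq' : q = i ∨ q = l := by
    by_contra hcon
    push Not at hcon
    exact ruleB hP hE hil m1.symm hij m2.symm hjl.symm m3 hm hq hcon.1 hcon.2
  have q1 : q ≠ j := by grind
  have hqs := hq.swap q1
  rcases hq' with rfl | rfl
  · exact ruleA hP hE hij.symm m3.symm m1.symm hjk.symm hik.symm m4.symm h1' hqs (Or.inl rfl)
  · exact ruleA hP hE hjl m3.symm m2.symm hjk.symm hkl m4.symm h3 hqs (Or.inl rfl)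

theorem no_ext {A B : Type*} {n : ℕ} (hn : 3 < n) {f g : (Fin n → A) → B}
    (hP : PairInv f) (hE : Ess f)
    (hD : ∀ i j : Fin n, i ≠ j → ∃ k, Dump f g i j k)
    {i j k : Fin n} (hij : i ≠ j) (hjk : k ≠ j) (h1 : Dump f g i j k) : False := by
  obtain ⟨l, hl⟩ : ∃ l, l ∉ ({i, j, k} : Finset (Fin n)) := by
    by_contra hcon
    push Not at hcon
    have h := Finset.card_le_card (fun x _ => hcon x : (Finset.univ : Finset (Fin n)) ⊆ _)
    have h' : ({i, j, k} : Finset (Fin n)).card ≤ 3 := Finset.card_le_three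
    rw [Finset.card_univ, Fintype.card_fin] at h
    omega
  simp only [Finset.mem_insert, Finset.mem_singleton, not_or] at hl
  obtain ⟨li, lj, lk⟩ := hl
  have hki := h1.1
  obtain ⟨m, hm⟩ := hD k l (Ne.symm lk)
  by_cases hmi : m = i
  · subst hmi
    exact no_ext_aux hP hE hD hij.symm hjk.symm (Ne.symm lj) hki.symm (Ne.symm li) (Ne.symm lk)
      (h1.swap hjk) hm
  · by_cases hmj : m = j
    · subst hmj
      exact no_ext_aux hP hE hD hij hki.symm (Ne.symm li) hjk.symm (Ne.symm lj) (Ne.symm lk) h1 hm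
    · exact ruleB hP hE hij hki.symm (Ne.symm li) hjk.symm (Ne.symm lj) (Ne.symm lk) h1 hm hmi hmj

theorem exists_rep {A : Type*} [Fintype A] {n : ℕ} (hn : Fintype.card A < n) (x : Fin n → A) :
    ∃ i j, i ≠ j ∧ x i = x j :=
  Fintype.exists_ne_map_eq_of_card_lt x (by simpa using hn)

theorem ess_or_const {A B : Type*} [Fintype A] {n : ℕ} (hn : Fintype.card A < n)
    {f : (Fin n → A) → B} (hP : PairInv f) (hS : TotallySymmetric f) :
    Ess f ∨ ∀ x y, f x = f y := by
  by_cases hE : Ess f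
  · exact Or.inl hE
  right
  unfold Ess at hE
  push Not at hE
  obtain ⟨p, q, s, hpq, hps, hqs, h⟩ := hE
  -- any coordinate other than p, q
  have h' : ∀ (t : Fin n), t ≠ p → t ≠ q → ∀ (x : Fin n → A) (b : A), x p = x q →
      f x = f (Function.update x t b) := by
    intro t htp htq x b hx
    have e1 := hS (Equiv.swap s t) x
    have e2 := hS (Equiv.swap s t) (Function.update x t b)
    rw [← e1, ← e2]
    have := h (fun r => x (Equiv.swap s t r)) b
      (by simp [Equiv.swap_apply_of_ne_of_ne, hps, hqs, htp.symm, htq.symm, hx])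
    rw [this]
    congr 1
    funext r
    by_cases hr : r = s
    · subst hr; simp
    · by_cases hr' : r = t
      · subst hr'; simp [Function.update_apply, hr, Ne.symm hr]
      · simp [Equiv.swap_apply_of_ne_of_ne hr hr', Function.update_apply, hr, hr']
  have hT : ∀ (T : Finset (Fin n)) , p ∉ T → q ∉ T → ∀ (x : Fin n → A) (b : A), x p = x q →
      f x = f (fun t => if t ∈ T then b else x t) := by
    intro T
    induction T using Finset.induction_on with
    | empty => intro _ _ x b _; simp
    | insert t T ht ih =>
      intro hp hq x b hx
      simp only [Finset.mem_insert, not_or] at hp hq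
      rw [ih hp.2 hq.2 x b hx, h' t (Ne.symm hp.1) (Ne.symm hq.1) _ b (by simp [hp.2, hq.2, hx])]
      congr 1
      funext r
      by_cases hr : r = t <;> simp [Function.update_apply, hr]
  have hC : ∀ (x : Fin n → A) (b : A), x p = x q → f x = f (fun _ => b) := by
    intro x b hx
    rw [hT ((Finset.univ.erase p).erase q) (by simp) (by simp) x b hx]
    apply hP p q _ _ hpq _ rfl
    · intro t h1 h2; simp [h1, h2]
    · simp [hx]
  have hC' : ∀ (x : Fin n → A) (b : A), f x = f (fun _ => b) := by
    intro x b
    obtain ⟨i, j, hij, hx⟩ := exists_rep hn x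
    obtain ⟨σ, hσ1, hσ2⟩ : ∃ σ : Equiv.Perm (Fin n), σ p = i ∧ σ q = j := by
      refine ⟨(Equiv.swap (Equiv.swap p i q) j) * Equiv.swap p i, ?_, ?_⟩
      · simp only [Equiv.Perm.mul_apply, Equiv.swap_apply_left]
        apply Equiv.swap_apply_of_ne_of_ne _ hij
        intro h
        have := congrArg (Equiv.swap p i) h
        simp at this
        exact hpq this
      · simp
    rw [← hS σ x]
    exact hC _ b (by simp [hσ1, hσ2, hx])
  intro x y
  rw [hC' x (x p), hC' y (x p)]

theorem deltaMap_facts {n : ℕ} (I : Finset (Fin n)) (hI : I.card = 2) :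
    ∃ p q : Fin n, p ≠ q ∧ I = {p, q} ∧ deltaMap I hI p = deltaMap I hI q ∧
      (∀ s t, s ≠ q → t ≠ q → deltaMap I hI s = deltaMap I hI t → s = t) ∧
      (∀ u, ∃ t, t ≠ q ∧ deltaMap I hI t = u) := by
  have hlt := min'_lt_max'_two hI
  refine ⟨I.min' (two_card_nonempty hI), I.max' (two_card_nonempty hI), ?_, ?_, ?_, ?_, ?_⟩
  · intro h; rw [h] at hlt; omega
  · symm
    apply Finset.eq_of_subset_of_card_le
    · intro t ht
      simp only [Finset.mem_insert, Finset.mem_singleton] at ht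
      rcases ht with rfl | rfl
      · exact Finset.min'_mem _ _
      · exact Finset.max'_mem _ _
    · rw [hI, Finset.card_pair]
      intro h; rw [h] at hlt; omega
  · simp [deltaMap, hlt]
  · intro s t hs ht h
    have hs' : s.val ≠ (I.max' (two_card_nonempty hI)).val := fun h => hs (Fin.ext h)
    have ht' : t.val ≠ (I.max' (two_card_nonempty hI)).val := fun h => ht (Fin.ext h)
    unfold deltaMap at h
    apply Fin.ext
    have := congrArg Fin.val h
    simp only [hs', ht', dite_false] at this
    split_ifs at this <;> simp at this <;> omega
  · intro u
    by_cases hu : u.val < (I.max' (two_card_nonempty hI)).val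
    · refine ⟨⟨u.val, by omega⟩, ?_, ?_⟩
      · intro h
        have := congrArg Fin.val h
        simp at this; omega
      · simp [deltaMap, hu]
    · refine ⟨⟨u.val + 1, by omega⟩, ?_, ?_⟩
      · intro h
        have := congrArg Fin.val h
        simp at this; omega
      · have h1 : ¬ (u.val + 1 < (I.max' (two_card_nonempty hI)).val) := by omega
        have h2 : ¬ (u.val + 1 = (I.max' (two_card_nonempty hI)).val) := by omega
        simp [deltaMap, h1, h2]

theorem dump_exists {A B : Type*} {n : ℕ} {f g : (Fin n → A) → B}
    (hP : PairInv f) (hS : TotallySymmetric f) (hg : IsReconstruction f g) :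
    ∀ i j : Fin n, i ≠ j → ∃ k, Dump f g i j k := by
  intro i j hij
  obtain ⟨φ, hφ⟩ := hg
  have hJ : ({i, j} : Finset (Fin n)).card = 2 := Finset.card_pair hij
  obtain ⟨I, hI⟩ := φ.surjective ⟨{i, j}, hJ⟩
  obtain ⟨σ, hσ⟩ := hφ I
  simp only [hI] at hσ
  simp only [minor] at hσ
  obtain ⟨p', q', hpq', -, hd1', hd2', hd3'⟩ := deltaMap_facts I.1 I.2
  obtain ⟨p, q, hpq, hpqI, hd1, hd2, hd3⟩ := deltaMap_facts {i, j} hJ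
  set δ' := deltaMap I.1 I.2
  set δ := deltaMap {i, j} hJ
  clear_value δ δ'
  choose s hs1 hs2 using hd3
  have hpqc : (p = i ∧ q = j) ∨ (p = j ∧ q = i) := by
    have hp : p ∈ ({i, j} : Finset (Fin n)) := by rw [hpqI]; simp
    have hq : q ∈ ({i, j} : Finset (Fin n)) := by rw [hpqI]; simp
    simp only [Finset.mem_insert, Finset.mem_singleton] at hp hq
    grind
  -- the composed map
  set r : Fin n := s (σ.symm (δ' p')) with hr
  have hrq : r ≠ q := hs1 _
  have sinj : Function.Injective s := fun a b h => by rw [← hs2 a, ← hs2 b, h]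
  have key : ∀ x : Fin n → A, x p = x q → g x = f (Function.update x q (x r)) := by
    intro x hx
    have hx1 : ∀ t, x (s (δ t)) = x t := by
      intro t
      by_cases ht : t = q
      · subst ht
        rw [← hd1, ← hx]
        congr 1
        exact hd2 _ _ (hs1 _) hpq (hs2 _)
      · congr 1
        exact hd2 _ _ (hs1 _) ht (hs2 _)
    have h := hσ (fun u => x (s (σ.symm u)))
    simp only [Equiv.symm_apply_apply, hx1] at h
    rw [← h]
    let ρ : Fin n → Fin n := fun t => if t = q' then q else s (σ.symm (δ' t))
    have ρinj : Function.Injective ρ := by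
      intro a b hab
      simp only [ρ] at hab
      split_ifs at hab with h1 h2 h2
      · rw [h1, h2]
      · exact absurd hab.symm (hs1 _)
      · exact absurd hab (hs1 _)
      · exact hd2' _ _ h1 h2 (σ.symm.injective (sinj hab))
    let π : Equiv.Perm (Fin n) := Equiv.ofBijective ρ (Finite.injective_iff_bijective.1 ρinj)
    rw [← hS π (Function.update x q (x r))]
    congr 1
    funext t
    show _ = Function.update x q (x r) (ρ t)
    by_cases ht : t = q'
    · subst ht
      simp [ρ, hr, hd1']
    · simp only [ρ, ht, if_false]
      rw [Function.update_of_ne (hs1 _)]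
  have key2 : ∀ x : Fin n → A, f (Function.update x q (x r)) = f (Function.update x r (x q)) := by
    intro x
    exact hP q r _ _ hrq.symm (by grind [Function.update_apply]) (by grind [Function.update_apply])
      (by grind [Function.update_apply])
  rcases hpqc with ⟨rfl, rfl⟩ | ⟨rfl, rfl⟩
  · by_cases hrp : r = p
    · exact ⟨q, hpq.symm, fun x hx => by rw [key x hx, hrp]⟩
    · exact ⟨r, hrp, fun x hx => by rw [key x hx, key2, hx]⟩
  · exact ⟨r, hrq, fun x hx => by rw [key x hx.symm, key2]⟩

/-- Functions determined by `oddsupp` of arity greater than max(|A|, 3) are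
reconstructible. -/
theorem oddsupp_reconstructible {A B : Type*} [Fintype A]
    (hA : 2 ≤ Fintype.card A) (hB : Nontrivial B) {n : ℕ}
    (hn : max (Fintype.card A) 3 < n)
    (f : (Fin n → A) → B) (hf : DeterminedByOddsupp f)
    (g : (Fin n → A) → B) (hg : IsReconstruction f g) :
    FEquiv f g := by
  have hn1 : Fintype.card A < n := lt_of_le_of_lt (le_max_left _ _) hn
  have hn2 : 3 < n := lt_of_le_of_lt (le_max_right _ _) hn
  have hP := pairInv_of_det hf
  have hS := symm_of_det hf
  have hD := dump_exists hP hS hg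
  refine ⟨1, fun x => ?_⟩
  show f x = g x
  obtain ⟨i, j, hij, hx⟩ := exists_rep hn1 x
  obtain ⟨k, hk⟩ := hD i j hij
  rw [hk.2 x hx]
  rcases ess_or_const hn1 hP hS with hE | hC
  · by_cases hkj : k = j
    · subst hkj
      rw [hx, Function.update_eq_self]
    · exact (no_ext hn2 hP hE hD hij hkj hk).elim
  · exact hC _ _
end

section
/- If f : A^n → B is 2-set-transitive, then f has a unique identification minor; that is, f_I ≡ f_J for all 2-element subsets I, J of {1,…,n}. -/
/-- A function is 2-set-transitive if its invariance group acts transitively on the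
2-element subsets of the index set. -/
def TwoSetTransitive {A B : Type*} {n : ℕ} (f : (Fin n → A) → B) : Prop :=
  ∀ (I J : Finset (Fin n)), I.card = 2 → J.card = 2 →
    ∃ σ : Equiv.Perm (Fin n),
      (∀ a : Fin n → A, f (fun t => a (σ t)) = f a) ∧ I.image ⇑σ = J

theorem deltaMap_eq_iff {n : ℕ} (I : Finset (Fin n)) (hI : I.card = 2) (s t : Fin n) :
    deltaMap I hI s = deltaMap I hI t ↔ s = t ∨ (s ∈ I ∧ t ∈ I) := by
  have hlt := min'_lt_max'_two hI
  have hmem : ∀ x : Fin n, x ∈ I ↔ ((x : ℕ) = (I.min' (two_card_nonempty hI)).val ∨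
      (x : ℕ) = (I.max' (two_card_nonempty hI)).val) := by
    have hsub : ({I.min' (two_card_nonempty hI), I.max' (two_card_nonempty hI)} :
        Finset (Fin n)) = I := by
      apply Finset.eq_of_subset_of_card_le
      · intro x hx
        rcases Finset.mem_insert.mp hx with h | h
        · rw [h]; exact Finset.min'_mem _ _
        · rw [Finset.mem_singleton.mp h]; exact Finset.max'_mem _ _
      · rw [hI, Finset.card_pair]
        intro h
        rw [← h] at hlt
        exact lt_irrefl _ hlt
    intro x
    rw [← Fin.ext_iff, ← Fin.ext_iff]
    constructor
    · intro hx
      rw [← hsub] at hx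
      simpa only [Finset.mem_insert, Finset.mem_singleton] using hx
    · rintro (h | h)
      · rw [h]; exact Finset.min'_mem _ _
      · rw [h]; exact Finset.max'_mem _ _
  rw [hmem, hmem, Fin.ext_iff, Fin.ext_iff]
  unfold deltaMap
  split_ifs <;> simp only [true_iff] <;> omega

theorem deltaMap_surjective {n : ℕ} (I : Finset (Fin n)) (hI : I.card = 2) :
    Function.Surjective (deltaMap I hI) := by
  intro y
  have hy := y.isLt
  by_cases h : (y : ℕ) < (I.max' (two_card_nonempty hI)).val
  · refine ⟨⟨y, by omega⟩, ?_⟩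
    simp [deltaMap, h]
  · refine ⟨⟨y + 1, by omega⟩, ?_⟩
    unfold deltaMap
    rw [dif_neg (by simp only; omega), dif_neg (by simp only; omega)]
    simp

/-- A 2-set-transitive function has a unique identification minor: all its identification
minors are pairwise equivalent. -/
theorem twoSetTransitive_unique_minor {A B : Type*} {n : ℕ}
    (f : (Fin n → A) → B) (hf : TwoSetTransitive f) :
    ∀ (I J : Finset (Fin n)) (hI : I.card = 2) (hJ : J.card = 2),
      FEquiv (minor f I hI) (minor f J hJ) := by
  intro I J hI hJ
  obtain ⟨σ, hσ, rfl⟩ := hf I J hI hJ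
  obtain ⟨s, hs⟩ := (deltaMap_surjective _ hJ).hasRightInverse
  have key : ∀ t, deltaMap I hI (σ.symm (s (deltaMap _ hJ (σ t)))) = deltaMap I hI t := by
    intro t
    rw [deltaMap_eq_iff]
    rcases (deltaMap_eq_iff _ hJ _ _).mp (hs (deltaMap _ hJ (σ t))) with h | ⟨h1, h2⟩
    · left; rw [h]; simp
    · right
      obtain ⟨u, hu, hu'⟩ := Finset.mem_image.mp h1
      obtain ⟨v, hv, hv'⟩ := Finset.mem_image.mp h2
      rw [← hu', Equiv.symm_apply_apply]
      exact ⟨hu, σ.injective hv' ▸ hv⟩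
  have hsurj : Function.Surjective (fun x => deltaMap I hI (σ.symm (s x))) := by
    intro y
    obtain ⟨t, rfl⟩ := deltaMap_surjective I hI y
    exact ⟨_, key t⟩
  refine ⟨Equiv.ofBijective _ (Finite.surjective_iff_bijective.mp hsurj), fun a => ?_⟩
  unfold minor
  rw [← hσ (fun t => a (Equiv.ofBijective _ (Finite.surjective_iff_bijective.mp hsurj)
    (deltaMap _ hJ t)))]
  congr 1
  funext t
  simp only [Equiv.ofBijective_apply, key]
end

section
/- Let σ be a permutation of {1,…,n} and let I be a 2-element subset of {1,…,n}. Then there exists a permutation σ̂ of {1,…,n−1} such that σ̂ ∘ δ_{Iσ⁻¹} = δ_I ∘ σ and σ̂(min(Iσ⁻¹)) = min I, where Iσ⁻¹ = {σ⁻¹(i) : i ∈ I}. -/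
theorem mem_two_iff {n : ℕ} {I : Finset (Fin n)} (hI : I.card = 2) (t : Fin n) :
    t ∈ I ↔ (t : ℕ) = (I.min' (two_card_nonempty hI)).val ∨
      (t : ℕ) = (I.max' (two_card_nonempty hI)).val := by
  have hlt := min'_lt_max'_two hI
  have hsub : ({I.min' (two_card_nonempty hI), I.max' (two_card_nonempty hI)} : Finset (Fin n))
      ⊆ I := by
    intro x hx
    simp only [Finset.mem_insert, Finset.mem_singleton] at hx
    rcases hx with rfl | rfl
    · exact Finset.min'_mem _ _
    · exact Finset.max'_mem _ _
  have hne : I.min' (two_card_nonempty hI) ≠ I.max' (two_card_nonempty hI) := by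
    intro h
    rw [h] at hlt
    exact lt_irrefl _ hlt
  have heq := Finset.eq_of_subset_of_card_le hsub (by rw [hI, Finset.card_pair hne])
  rw [← Fin.ext_iff, ← Fin.ext_iff]
  have h2 : t ∈ I ↔
      t ∈ ({I.min' (two_card_nonempty hI), I.max' (two_card_nonempty hI)} : Finset (Fin n)) := by
    rw [heq]
  rw [h2, Finset.mem_insert, Finset.mem_singleton]

theorem deltaMap_val {n : ℕ} (I : Finset (Fin n)) (hI : I.card = 2) (t : Fin n) :
    (deltaMap I hI t : ℕ) = if (t : ℕ) < (I.max' (two_card_nonempty hI)).val then (t : ℕ)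
      else if (t : ℕ) = (I.max' (two_card_nonempty hI)).val then
        (I.min' (two_card_nonempty hI)).val else (t : ℕ) - 1 := by
  unfold deltaMap
  split_ifs <;> rfl

theorem deltaMap_min {n : ℕ} (I : Finset (Fin n)) (hI : I.card = 2) (t : Fin n) (ht : t ∈ I) :
    deltaMap I hI t = ⟨(I.min' (two_card_nonempty hI)).val, min'_lt_pred hI⟩ := by
  have hlt := min'_lt_max'_two hI
  rw [mem_two_iff hI] at ht
  rw [Fin.ext_iff, deltaMap_val]
  split_ifs <;> simp only <;> omega

/-- For every permutation `σ` of `{1,…,n}` and every 2-element subset `I` there is a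
permutation `σ̂` of `{1,…,n−1}` with `σ̂ ∘ δ_{Iσ⁻¹} = δ_I ∘ σ` and
`σ̂(min (Iσ⁻¹)) = min I`. -/
theorem hatSigma_exists {n : ℕ} (σ : Equiv.Perm (Fin n)) (I : Finset (Fin n))
    (hI : I.card = 2) :
    ∃ σhat : Equiv.Perm (Fin (n - 1)),
      (∀ t : Fin n,
        σhat (deltaMap (I.image ⇑σ.symm)
            ((Finset.card_image_of_injective I σ.symm.injective).trans hI) t) =
          deltaMap I hI (σ t)) ∧
      σhat ⟨((I.image ⇑σ.symm).min' (two_card_nonempty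
              ((Finset.card_image_of_injective I σ.symm.injective).trans hI))).val,
            min'_lt_pred ((Finset.card_image_of_injective I σ.symm.injective).trans hI)⟩ =
        ⟨(I.min' (two_card_nonempty hI)).val, min'_lt_pred hI⟩ := by
  have hJ := (Finset.card_image_of_injective I σ.symm.injective).trans hI
  have hmem : ∀ t, t ∈ I.image ⇑σ.symm ↔ σ t ∈ I := by
    intro t
    simp only [Finset.mem_image]
    constructor
    · rintro ⟨a, ha, rfl⟩
      simpa using ha
    · intro h
      exact ⟨σ t, h, by simp⟩
  have key : ∀ s t, deltaMap (I.image ⇑σ.symm) hJ s = deltaMap (I.image ⇑σ.symm) hJ t ↔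
      deltaMap I hI (σ s) = deltaMap I hI (σ t) := by
    intro s t
    rw [deltaMap_eq_iff, deltaMap_eq_iff, hmem, hmem, σ.injective.eq_iff]
  choose g hg using deltaMap_surjective (I.image ⇑σ.symm) hJ
  have hinj : Function.Injective (fun x => deltaMap I hI (σ (g x))) := by
    intro x y hxy
    have h := (key _ _).2 hxy
    rwa [hg, hg] at h
  have hcomm : ∀ t, deltaMap I hI (σ (g (deltaMap (I.image ⇑σ.symm) hJ t))) =
      deltaMap I hI (σ t) := fun t => (key _ _).1 (hg _)
  refine ⟨Equiv.ofBijective _ (Finite.injective_iff_bijective.1 hinj), hcomm, ?_⟩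
  have hm := Finset.min'_mem (I.image ⇑σ.symm) (two_card_nonempty hJ)
  rw [← deltaMap_min _ hJ _ hm, ← deltaMap_min I hI _ ((hmem _).1 hm)]
  exact hcomm _
end
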